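/- If G is a 1-tough graph on n ≥ 3 vertices with σ₃(G) ≥ n, then every longest cycle in G is a dominating cycle (i.e., the vertices not on the cycle form an independent set). -/

import Mathlib

open scoped Classical

namespace Paper

noncomputable section

variable {V : Type*}

/-- degree as cardinality of neighbor set -/
def deg (G : SimpleGraph V) (x : V) : ℕ := (G.neighborSet x).ncard

/-- G is 1-tough -/
def OneTough (G : SimpleGraph V) : Prop :=
  ∀ S : Set V, S.Nonempty → Nat.card ((G.induce Sᶜ).ConnectedComponent) ≤ S.ncard

def IsIndepTriple (G : SimpleGraph V) (s : Finset V) : Prop :=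
  s.card = 3 ∧ ∀ x ∈ s, ∀ y ∈ s, x ≠ y → ¬ G.Adj x y

def sigma3 [Fintype V] (G : SimpleGraph V) : ℕ :=
  if ∃ s : Finset V, IsIndepTriple G s then
    sInf {k | ∃ s : Finset V, IsIndepTriple G s ∧ ∑ x ∈ s, deg G x = k}
  else 3 * (Fintype.card V - 1)

def NC2 [Fintype V] (G : SimpleGraph V) : ℕ :=
  if G = ⊤ then Fintype.card V - 1
  else sInf {k | ∃ x y : V, G.dist x y = 2 ∧ (G.neighborSet x ∪ G.neighborSet y).ncard = k}

def circumference (G : SimpleGraph V) : ℕ :=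
  sSup {k | ∃ (a : V) (w : G.Walk a a), w.IsCycle ∧ w.length = k}

def IsLongestCycle (G : SimpleGraph V) {a : V} (c : G.Walk a a) : Prop :=
  c.IsCycle ∧ ∀ (b : V) (w : G.Walk b b), w.IsCycle → w.length ≤ c.length

/-- successor of a vertex along the oriented cycle `c` (identity off the cycle) -/
def cSucc [DecidableEq V] {G : SimpleGraph V} {a : V} (c : G.Walk a a) (x : V) : V :=
  if h : x ∈ c.support.tail then c.support.tail.next x h else x

/-- predecessor of a vertex along the oriented cycle `c` (identity off the cycle) -/
def cPred [DecidableEq V] {G : SimpleGraph V} {a : V} (c : G.Walk a a) (x : V) : V :=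
  if h : x ∈ c.support.tail then c.support.tail.prev x h else x

/-- vertices strictly between `x` and `y` going forward along `c` -/
def arc [DecidableEq V] {G : SimpleGraph V} {a : V} (c : G.Walk a a) (x y : V) : Set V :=
  {z | ∃ i k : ℕ, 0 < i ∧ i < k ∧ k < c.length ∧ (cSucc c)^[k] x = y ∧ z = (cSucc c)^[i] x}

/-- length of the interval of the cycle `c` starting at `b` determined by `B` -/
def intervalLen [DecidableEq V] {G : SimpleGraph V} {a : V} (c : G.Walk a a)
    (B : Set V) (b : V) : ℕ :=
  sInf {k | 0 < k ∧ (cSucc c)^[k] b ∈ B}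

/-- inner vertices of the interval of the cycle `c` starting at `b` determined by `B` -/
def innerVerts [DecidableEq V] {G : SimpleGraph V} {a : V} (c : G.Walk a a)
    (B : Set V) (b : V) : Set V :=
  {x | ∃ i, 0 < i ∧ i < intervalLen c B b ∧ x = (cSucc c)^[i] b}

/-- the union of the neighborhoods of the vertices in `S` -/
def nbhdSet (G : SimpleGraph V) (S : Set V) : Set V := {z | ∃ y ∈ S, G.Adj y z}

/-- a set of vertices is independent -/
def IsIndepSet (G : SimpleGraph V) (S : Set V) : Prop :=
  ∀ x ∈ S, ∀ y ∈ S, ¬ G.Adj x y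

/-- `L` is a nonempty list of consecutively adjacent vertices leading from `a` to `b`. -/
def Pth (G : SimpleGraph V) (a : V) (L : List V) (b : V) : Prop :=
  L.IsChain G.Adj ∧ L.head? = some a ∧ L.getLast? = some b

/-- `W` is the (possibly empty) list of inner vertices of a route from `a` to `b`. -/
def Link (G : SimpleGraph V) (a : V) (W : List V) (b : V) : Prop :=
  (a :: (W ++ [b])).IsChain G.Adj

section Lists

variable {G : SimpleGraph V} {a b c d e f y z u v : V} {L M W X Y F : List V}

theorem link_nil : Link G a [] b ↔ G.Adj a b := by simp [Link]

theorem Link.rev (h : Link G a W b) : Link G b W.reverse a := by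
  have := (List.isChain_reverse (R := G.Adj)).2 (h.imp fun _ _ h => h.symm)
  simpa [Link] using this

theorem Pth.rev (h : Pth G a L b) : Pth G b L.reverse a := by
  refine ⟨(List.isChain_reverse (R := G.Adj)).2 (h.1.imp fun _ _ h => h.symm), ?_, ?_⟩
  · simpa using h.2.2
  · simpa using h.2.1

theorem Pth.exists_cons (h : Pth G a L b) : ∃ T, L = a :: T := by
  cases L with
  | nil => simp [Pth] at h
  | cons x T => exact ⟨T, by simpa using h.2.1⟩

theorem Pth.exists_snoc (h : Pth G a L b) : ∃ T, L = T ++ [b] := by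
  obtain ⟨T, hT⟩ := h.rev.exists_cons
  exact ⟨T.reverse, by simpa using congrArg List.reverse hT⟩

theorem Pth.ne_nil (h : Pth G a L b) : L ≠ [] := by
  obtain ⟨T, rfl⟩ := h.exists_cons; simp

theorem Pth.head_mem (h : Pth G a L b) : a ∈ L := by
  obtain ⟨T, rfl⟩ := h.exists_cons; simp

theorem Pth.last_mem (h : Pth G a L b) : b ∈ L := by
  obtain ⟨T, rfl⟩ := h.exists_snoc; simp

theorem Pth.link (h : Pth G a L y) (hW : Link G y W z) (h' : Pth G z M d) :
    Pth G a (L ++ (W ++ M)) d := by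
  obtain ⟨T, rfl⟩ := h.exists_snoc
  obtain ⟨U, rfl⟩ := h'.exists_cons
  refine ⟨?_, ?_, ?_⟩
  · have h1 := h.1
    have h2 := h'.1
    have h3 := hW
    unfold Link at h3
    have e1 : T ++ [y] ++ (W ++ z :: U) = T ++ y :: (W ++ z :: U) := by simp
    rw [e1, List.isChain_split]
    refine ⟨h1, ?_⟩
    have e2 : y :: (W ++ z :: U) = (y :: W) ++ z :: U := by simp
    rw [e2, List.isChain_split]
    exact ⟨by simpa using h3, h2⟩
  · have := h.2.1
    cases T <;> simp_all
  · obtain ⟨T', hT'⟩ := h'.exists_snoc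
    rw [hT', show T ++ [y] ++ (W ++ (T' ++ [d])) = (T ++ [y] ++ W ++ T') ++ [d] by simp]
    exact List.getLast?_concat

theorem Pth.app (h : Pth G a L y) (hW : G.Adj y z) (h' : Pth G z M d) :
    Pth G a (L ++ M) d := by
  simpa using h.link (link_nil.2 hW) h'

theorem Pth.drop (h : Pth G a (X ++ e :: Y) b) : Pth G e (e :: Y) b := by
  refine ⟨(List.isChain_split.1 h.1).2, by simp, ?_⟩
  have := h.2.2
  simpa [List.getLast?_append] using this

theorem Pth.take (h : Pth G a (X ++ e :: Y) b) : Pth G a (X ++ [e]) e := by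
  refine ⟨(List.isChain_split.1 h.1).1, ?_, by simp⟩
  have := h.2.1
  cases X <;> simp_all

theorem Pth.adj (h : Pth G a (X ++ e :: f :: Y) b) : G.Adj e f := by
  have := h.drop.1
  simp at this
  exact this.1

theorem pth_singleton : Pth G a [a] a := by simp [Pth]

theorem split_unique {l : List V} (hl : l.Nodup) {X' Y' : List V} (h : l = X ++ e :: Y)
    (h' : l = X' ++ e :: Y') : X = X' ∧ Y = Y' := by
  subst h
  induction X generalizing X' with
  | nil =>
    cases X' with
    | nil => simpa using h'
    | cons x X' =>
      simp at h'
      obtain ⟨rfl, rfl⟩ := h'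
      simp at hl
  | cons x X ih =>
    cases X' with
    | nil =>
      simp at h'
      obtain ⟨rfl, rfl⟩ := h'
      simp at hl
    | cons x' X' =>
      simp at h'
      obtain ⟨rfl, h2⟩ := h'
      simp only [List.cons_append, List.nodup_cons] at hl
      obtain ⟨rfl, rfl⟩ := ih hl.2 h2
      simp

theorem exists_first (p : V → Prop) (l : List V) :
    (∀ x ∈ l, ¬ p x) ∨ ∃ X c Y, l = X ++ c :: Y ∧ p c ∧ ∀ x ∈ X, ¬ p x := by
  induction l with
  | nil => simp
  | cons x l ih =>
    by_cases hx : p x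
    · exact Or.inr ⟨[], x, l, by simp, hx, by simp⟩
    · rcases ih with h | ⟨X, c, Y, rfl, hc, hX⟩
      · left; simpa using ⟨hx, h⟩
      · exact Or.inr ⟨x :: X, c, Y, by simp, hc, by simpa using ⟨hx, hX⟩⟩

theorem exists_last (p : V → Prop) (l : List V) :
    (∀ x ∈ l, ¬ p x) ∨ ∃ X c Y, l = X ++ c :: Y ∧ p c ∧ ∀ x ∈ Y, ¬ p x := by
  rcases exists_first p l.reverse with h | ⟨X, c, Y, h, hc, hX⟩
  · left; simpa using h
  · refine Or.inr ⟨Y.reverse, c, X.reverse, ?_, hc, by simpa using hX⟩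
    simpa using congrArg List.reverse h

theorem exists_snoc_of_ne_nil {l : List V} (h : l ≠ []) : ∃ X e, l = X ++ [e] :=
  ⟨l.dropLast, l.getLast h, (List.dropLast_append_getLast h).symm⟩

/-- `e` occurs in `L`, fails `q`, and its successor in `L` (if any) fails `p`. -/
def Deficient (p q : V → Prop) (L : List V) (e : V) : Prop :=
  ∃ X Y, L = X ++ e :: Y ∧ ¬ q e ∧ ∀ e' ∈ Y.head?, ¬ p e'

theorem count_add_count_add_deficient_le (p q : V → Prop) :
    ∀ (L : List V), L.Nodup →
      (∀ X e e' Y, L = X ++ e :: e' :: Y → ¬ (q e ∧ p e')) →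
      ∀ D : Finset V, (∀ e ∈ D, Deficient p q L e) →
        L.tail.countP (fun x => p x) + L.countP (fun x => q x) + D.card ≤ L.length := by
  intro L
  induction L with
  | nil =>
    intro _ _ D hD
    have : D = ∅ := by
      refine Finset.eq_empty_of_forall_notMem fun e he => ?_
      obtain ⟨X, Y, h, _⟩ := hD e he
      simp at h
    simp [this]
  | cons x L ih =>
    intro hnd hpq D hD
    have hnd' := List.nodup_cons.1 hnd
    have h1 := ih hnd'.2 (fun X e e' Y h => hpq (x :: X) e e' Y (by simp [h])) (D.erase x) (by
      intro e he
      obtain ⟨hne, he⟩ := Finset.mem_erase.1 he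
      obtain ⟨X, Y, h, h2, h3⟩ := hD e he
      cases X with
      | nil => simp at h; exact absurd h.1.symm hne
      | cons x' X =>
        simp at h
        exact ⟨X, Y, h.2, h2, h3⟩)
    have hx : x ∈ D → ¬ q x ∧ ∀ e' ∈ L.head?, ¬ p e' := by
      intro hx
      obtain ⟨X, Y, h, h2, h3⟩ := hD x hx
      obtain ⟨rfl, rfl⟩ := split_unique (X := []) (Y := L) hnd (by simp) h
      exact ⟨h2, h3⟩
    have hcard : D.card ≤ (D.erase x).card + if x ∈ D then 1 else 0 := by
      split_ifs with h
      · rw [Finset.card_erase_of_mem h]; omega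
      · rw [Finset.erase_eq_of_notMem h]; omega
    have key : (L.countP fun x => p x) + (if q x then 1 else 0) + (if x ∈ D then 1 else 0) ≤
        L.tail.countP (fun x => p x) + 1 := by
      cases L with
      | nil =>
        simp
        by_cases hxD : x ∈ D
        · simp [hxD, (hx hxD).1]
        · simp [hxD]; split_ifs <;> simp
      | cons y L =>
        simp only [List.countP_cons, List.tail_cons]
        have hq := hpq [] x y L (by simp)
        by_cases hxD : x ∈ D
        · have := hx hxD
          simp at this
          simp [hxD, this.1, this.2]
        · by_cases hqx : q x
          · have : ¬ p y := fun h => hq ⟨hqx, h⟩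
            simp [hxD, hqx, this]
          · simp [hxD, hqx]; split_ifs <;> simp
    simp only [List.tail_cons, List.length_cons, List.countP_cons, decide_eq_true_eq]
    omega

end Lists

/-- `P` is a list of at least `n` distinct vertices of `H` linking `u` to `v`. -/
def HLink (G : SimpleGraph V) (H : Finset V) (n : ℕ) (u : V) (P : List V) (v : V) : Prop :=
  Link G u P v ∧ P.Nodup ∧ (∀ x ∈ P, x ∈ H) ∧ n ≤ P.length

/-- `W` consists of distinct vertices outside `C` and `H`. -/
def OutList (C : List V) (H : Finset V) (W : List V) : Prop :=
  W.Nodup ∧ ∀ w ∈ W, w ∉ C ∧ w ∉ H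

/-- `y` and `z` are linked by a path all of whose inner vertices avoid `C` and `H`. -/
def Cross (G : SimpleGraph V) (C : List V) (H : Finset V) (y z : V) : Prop :=
  ∃ W, OutList C H W ∧ Link G y W z

/-- A longest cycle `C`, a set `H` of vertices off `C` and the set `A` of its attachments. -/
structure Sit [Fintype V] (G : SimpleGraph V) (C : List V) (H A : Finset V) : Prop where
  nodup : C.Nodup
  len : 3 ≤ C.length
  mx : ∀ a b L, Pth G a L b → G.Adj b a → L.Nodup → 3 ≤ L.length → L.length ≤ C.length
  disj : ∀ h ∈ H, h ∉ C
  sub : ∀ c ∈ A, c ∈ C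
  closed : ∀ h ∈ H, ∀ v, G.Adj h v → v ∈ H ∨ v ∈ A
  lk : ∀ u ∈ A, ∀ v ∈ A, u ≠ v → ∃ P, HLink G H 1 u P v
  sig : ∀ x y z, x ≠ y → y ≠ z → x ≠ z → ¬ G.Adj x y → ¬ G.Adj y z → ¬ G.Adj x z →
    Fintype.card V ≤ deg G x + deg G y + deg G z

section Basic

variable {G : SimpleGraph V} {C : List V} {H A : Finset V}
  {a b c e e' s t u v y z : V} {L L₁ L₂ K E lost P W X Y F : List V} {n : ℕ}

theorem HLink.rev (h : HLink G H n u P v) : HLink G H n v P.reverse u :=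
  ⟨h.1.rev, by simpa using h.2.1, by simpa using h.2.2.1, by simpa using h.2.2.2⟩

theorem OutList.rev (h : OutList C H W) : OutList C H W.reverse :=
  ⟨by simpa using h.1, by simpa using h.2⟩

theorem outList_nil : OutList C H [] := by simp [OutList]

theorem outList_singleton (hC : y ∉ C) (hH : y ∉ H) : OutList C H [y] := by
  simp [OutList, hC, hH]

theorem Cross.symm (h : Cross G C H y z) : Cross G C H z y := by
  obtain ⟨W, h1, h2⟩ := h
  exact ⟨W.reverse, h1.rev, h2.rev⟩

theorem cross_of_adj (h : G.Adj y z) : Cross G C H y z := ⟨[], outList_nil, link_nil.2 h⟩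

theorem Pth.close (h : Pth G a L b) (hW : Link G b W a) :
    ∃ b', Pth G a (L ++ W) b' ∧ G.Adj b' a := by
  rcases List.eq_nil_or_concat W with rfl | ⟨W', w, rfl⟩
  · exact ⟨b, by simpa using h, link_nil.1 hW⟩
  · unfold Link at hW
    simp only [List.concat_eq_append] at hW ⊢
    have h1 : (b :: (W' ++ w :: [a])).IsChain G.Adj := by simpa using hW
    have h2 : ((b :: W') ++ w :: [a]).IsChain G.Adj := h1
    rw [List.isChain_split] at h2
    refine ⟨w, h.link (W := W') ?_ pth_singleton, by simpa using h2.2⟩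
    simpa [Link] using h2.1

theorem nodup_ext (hP : HLink G H n u P v) (hW : OutList C H W) : (P ++ W).Nodup := by
  rw [List.nodup_append]
  refine ⟨hP.2.1, hW.1, ?_⟩
  rintro x hx y hy rfl
  exact (hW.2 x hy).2 (hP.2.2.1 x hx)

variable [Fintype V]

theorem Sit.no_longer (S : Sit G C H A) (hL : Pth G a L b) (hba : G.Adj b a)
    (hp : (L ++ lost).Perm (K ++ E)) (hK : K.Perm C) (hE : E.Nodup) (hEC : ∀ x ∈ E, x ∉ C)
    (hlt : lost.length < E.length) : False := by
  have hnd : (K ++ E).Nodup := by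
    rw [List.nodup_append]
    refine ⟨hK.nodup_iff.2 S.nodup, hE, ?_⟩
    rintro x hx y hy rfl
    exact hEC x hy (hK.mem_iff.1 hx)
  have hnd' := (List.nodup_append.1 (hp.nodup_iff.2 hnd)).1
  have hlen := hp.length_eq
  simp only [List.length_append, hK.length_eq] at hlen
  have := S.mx a b L hL hba hnd' (by have := S.len; omega)
  omega

theorem Sit.notMem (S : Sit G C H A) (hP : HLink G H n u P v) : ∀ x ∈ P, x ∉ C :=
  fun x hx => S.disj x (hP.2.2.1 x hx)

theorem Sit.ext_notMem (S : Sit G C H A) (hP : HLink G H n u P v) (hW : OutList C H W) :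
    ∀ x ∈ P ++ W, x ∉ C := by
  intro x hx
  rcases List.mem_append.1 hx with hx | hx
  · exact S.notMem hP x hx
  · exact (hW.2 x hx).1

theorem Sit.pair_cross (S : Sit G C H A) (h₁ : Pth G a (X ++ e :: (F ++ e' :: Y)) v)
    (h₂ : Pth G b L₂ u) (hC : (X ++ e :: (F ++ e' :: Y) ++ L₂).Perm C)
    (hP : HLink G H n u P v) (hW : OutList C H W) (hbe : Link G b W e)
    (hF : F.length < P.length + W.length) : ¬ G.Adj a e' := by
  intro hae
  have h₃ : Pth G a ((X ++ e :: F) ++ e' :: Y) v := by simpa using h₁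
  have := h₁.take.link hbe.rev (h₂.link hP.1 h₃.drop.rev)
  refine S.no_longer (E := P ++ W) (lost := F) this hae.symm ?_ hC (nodup_ext hP hW)
    (S.ext_notMem hP hW) (by simpa using hF)
  refine List.perm_iff_count.2 fun x => ?_
  simp only [List.count_append, List.count_reverse, List.count_cons, List.count_nil]
  omega

theorem Sit.single_cross (S : Sit G C H A) (h₁ : Pth G a (X ++ c :: (F ++ e' :: Y)) u)
    (hC : (X ++ c :: (F ++ e' :: Y)).Perm C) (hP : HLink G H n c P u)
    (hF : F.length < P.length) : ¬ G.Adj a e' := by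
  intro hae
  have h₃ : Pth G a ((X ++ c :: F) ++ e' :: Y) u := by simpa using h₁
  have := h₁.take.link hP.1 h₃.drop.rev
  refine S.no_longer (E := P) (lost := F) this hae.symm ?_ hC hP.2.1 (S.notMem hP) hF
  refine List.perm_iff_count.2 fun x => ?_
  simp only [List.count_append, List.count_reverse, List.count_cons, List.count_nil]
  omega

theorem Sit.pair_unlinked (S : Sit G C H A) (h₁ : Pth G a L₁ v) (h₂ : Pth G b L₂ u)
    (hC : (L₁ ++ L₂).Perm C) (hP : HLink G H 1 u P v) (hW : OutList C H W) :
    ¬ Link G a W b := by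
  intro hab
  obtain ⟨b', h3, h4⟩ := (h₁.link hP.rev.1 h₂.rev).close hab.rev
  refine S.no_longer (E := P ++ W) (lost := []) h3 h4 ?_ hC (nodup_ext hP hW)
    (S.ext_notMem hP hW) ?_
  · refine List.perm_iff_count.2 fun x => ?_
    simp only [List.count_append, List.count_reverse, List.count_nil]
    omega
  · have := hP.2.2.2
    simp
    omega

end Basic

section Counting

variable [Fintype V] {G : SimpleGraph V} {C : List V} {H A : Finset V}
  {a b h u v x : V} {L₁ L₂ P : List V}

theorem deg_eq_countP_add (hC : C.Nodup) : deg G x =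
    C.countP (fun y => G.Adj x y) +
      (Finset.univ.filter fun y => G.Adj x y ∧ y ∉ C).card := by
  have h1 : C.countP (fun y => G.Adj x y) = (C.toFinset.filter fun y => G.Adj x y).card := by
    rw [List.countP_eq_length_filter, ← List.toFinset_card_of_nodup (hC.filter _),
      List.toFinset_filter]
    simp
  rw [h1, ← Finset.card_union_of_disjoint, deg, Set.ncard_eq_toFinset_card']
  · congr 1
    ext y
    by_cases hy : y ∈ C <;> simp [hy]
  · rw [Finset.disjoint_left]
    intro y hy hy'
    simp at hy hy'
    exact hy'.2 hy.1

theorem Sit.deg_add_one_le (S : Sit G C H A) (hh : h ∈ H) :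
    deg G h + 1 ≤ H.card + (A.filter fun c => G.Adj h c).card := by
  have h1 : deg G h ≤ (H.erase h ∪ A.filter fun c => G.Adj h c).card := by
    rw [deg, Set.ncard_eq_toFinset_card']
    refine Finset.card_le_card fun y hy => ?_
    have hy : G.Adj h y := by simpa using hy
    rcases S.closed h hh y hy with hyH | hyA
    · simp [hyH, hy.ne']
    · simp [hyA, hy]
  have h2 := Finset.card_union_le (H.erase h) (A.filter fun c => G.Adj h c)
  have h3 := Finset.card_erase_add_one hh
  omega

theorem Sit.not_adj (S : Sit G C H A) (ha : a ∈ C) (haA : a ∉ A) (hh : h ∈ H) :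
    ¬ G.Adj a h := by
  intro hah
  rcases S.closed h hh a hah.symm with h1 | h1
  · exact S.disj a h1 ha
  · exact haA h1

theorem Sit.key (S : Sit G C H A) (h₁ : Pth G a L₁ v) (h₂ : Pth G b L₂ u)
    (hC : (L₁ ++ L₂).Perm C) (hP : HLink G H 1 u P v) (haA : a ∉ A) (hbA : b ∉ A)
    {D₁ D₂ : Finset V} (hD₁ : ∀ e ∈ D₁, Deficient (G.Adj a) (G.Adj b) L₁ e)
    (hD₂ : ∀ e ∈ D₂, Deficient (G.Adj b) (G.Adj a) L₂ e) (hh : h ∈ H) :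
    D₁.card + D₂.card + H.card ≤ deg G h := by
  have hnd : (L₁ ++ L₂).Nodup := hC.nodup_iff.2 S.nodup
  have hnd' := List.nodup_append.1 hnd
  have haC : a ∈ C := hC.mem_iff.1 (by simp [h₁.head_mem])
  have hbC : b ∈ C := hC.mem_iff.1 (by simp [h₂.head_mem])
  have hC' : (L₂ ++ L₁).Perm C := List.perm_append_comm.trans hC
  have hPlen := hP.2.2.2
  have c1 := count_add_count_add_deficient_le (G.Adj a) (G.Adj b) L₁ hnd'.1 (by
    rintro X e e' Y rfl ⟨h3, h4⟩
    exact S.pair_cross (F := []) h₁ h₂ hC hP outList_nil (link_nil.2 h3)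
      (by simp; omega) h4) D₁ hD₁
  have c2 := count_add_count_add_deficient_le (G.Adj b) (G.Adj a) L₂ hnd'.2.1 (by
    rintro X e e' Y rfl ⟨h3, h4⟩
    exact S.pair_cross (F := []) h₂ h₁ hC' hP.rev outList_nil (link_nil.2 h3)
      (by simp; omega) h4) D₂ hD₂
  have t1 : L₁.countP (fun y => G.Adj a y) = L₁.tail.countP (fun y => G.Adj a y) := by
    obtain ⟨T, rfl⟩ := h₁.exists_cons
    simp
  have t2 : L₂.countP (fun y => G.Adj b y) = L₂.tail.countP (fun y => G.Adj b y) := by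
    obtain ⟨T, rfl⟩ := h₂.exists_cons
    simp
  have d1 := deg_eq_countP_add (G := G) (x := a) hnd
  have d2 := deg_eq_countP_add (G := G) (x := b) hnd
  rw [List.countP_append] at d1 d2
  set Oa := Finset.univ.filter fun y => G.Adj a y ∧ y ∉ L₁ ++ L₂ with hOa
  set Ob := Finset.univ.filter fun y => G.Adj b y ∧ y ∉ L₁ ++ L₂ with hOb
  have htot : (L₁ ++ L₂).toFinset.card + (Oa.card + Ob.card + H.card) ≤ Fintype.card V := by
    have e1 : Disjoint Oa Ob := by
      rw [Finset.disjoint_left]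
      intro y hy hy'
      simp only [hOa, hOb, Finset.mem_filter, Finset.mem_univ, true_and] at hy hy'
      have hyC : y ∉ C := fun h => hy.2 (hC.mem_iff.2 h)
      have hyH : y ∉ H := fun h => S.not_adj haC haA h hy.1
      refine S.pair_unlinked h₁ h₂ hC hP (outList_singleton hyC hyH) ?_
      simp [Link, hy.1, hy'.1.symm]
    have e2 : Disjoint (Oa ∪ Ob) H := by
      rw [Finset.disjoint_left]
      intro y hy hyH
      rcases Finset.mem_union.1 hy with hy | hy <;>
        simp only [hOa, hOb, Finset.mem_filter, Finset.mem_univ, true_and] at hy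
      · exact S.not_adj haC haA hyH hy.1
      · exact S.not_adj hbC hbA hyH hy.1
    have e3 : Disjoint (L₁ ++ L₂).toFinset (Oa ∪ Ob ∪ H) := by
      rw [Finset.disjoint_left]
      intro y hy hy'
      have hy := List.mem_toFinset.1 hy
      rcases Finset.mem_union.1 hy' with hy' | hy'
      · rcases Finset.mem_union.1 hy' with hy' | hy' <;>
          simp only [hOa, hOb, Finset.mem_filter, Finset.mem_univ, true_and] at hy'
        · exact hy'.2 hy
        · exact hy'.2 hy
      · exact S.disj y hy' (hC.mem_iff.1 hy)
    rw [← Finset.card_union_of_disjoint e1, ← Finset.card_union_of_disjoint e2,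
      ← Finset.card_union_of_disjoint e3]
    exact Finset.card_le_univ _
  rw [List.toFinset_card_of_nodup hnd, List.length_append] at htot
  have hab : a ≠ b := hnd'.2.2 a h₁.head_mem b h₂.head_mem
  have hsig := S.sig a b h hab (fun e => S.disj h hh (e ▸ hbC))
    (fun e => S.disj h hh (e ▸ haC))
    (fun hadj => S.pair_unlinked h₁ h₂ hC hP outList_nil (link_nil.2 hadj))
    (S.not_adj hbC hbA hh) (S.not_adj haC haA hh)
  omega

end Counting

/-- A cyclic arrangement `Q, M, R, N` of a longest cycle in which `Q` and `R` are attachment-free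
blocks, each followed by an attachment, starting right after the attachments `u` and `v`. -/
structure Cfg (G : SimpleGraph V) (C : List V) (A : Finset V) (Q M R N : List V)
    (a b u v : V) : Prop where
  perm : (Q ++ M ++ (R ++ N)).Perm C
  pa : Pth G a (Q ++ M) v
  pb : Pth G b (R ++ N) u
  ua : G.Adj u a
  vb : G.Adj v b
  neQ : Q ≠ []
  neR : R ≠ []
  avQ : ∀ x ∈ Q, x ∉ A
  avR : ∀ x ∈ R, x ∉ A
  hM : ∀ x ∈ M.head?, x ∈ A
  hN : ∀ x ∈ N.head?, x ∈ A
  uA : u ∈ A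
  vA : v ∈ A

/-- `e` is a deficient entry of `L` that is preceded by no element of `A`. -/
def DefX (A : Finset V) (p q : V → Prop) (L : List V) (e : V) : Prop :=
  ∃ X Y, L = X ++ e :: Y ∧ ¬ q e ∧ (∀ e' ∈ Y.head?, ¬ p e') ∧ ∀ x ∈ X, x ∉ A

/-- `e` is a deficient entry, preceded by no element of `A`, of one of the two paths. -/
def Extra (G : SimpleGraph V) (A : Finset V) (s b : V) (L₁ L₂ : List V) (e : V) : Prop :=
  DefX A (G.Adj s) (G.Adj b) L₁ e ∨ DefX A (G.Adj b) (G.Adj s) L₂ e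

/-- A `Sit` with long links and an `H`-vertex of extremal degree. -/
structure Sit2 [Fintype V] (G : SimpleGraph V) (C : List V) (H A : Finset V) (h₀ : V) : Prop
    extends Sit G C H A where
  lk2 : ∀ u ∈ A, ∀ v ∈ A, u ≠ v → ∃ P, HLink G H 2 u P v
  h₀_mem : h₀ ∈ H
  best : ∀ a b L s t, Pth G a L b → G.Adj b a → L.Nodup → L.length = C.length →
    s ∉ L → t ∉ L → G.Adj s t → deg G s ≤ deg G h₀

section Forced

variable {G : SimpleGraph V} {C : List V} {H A : Finset V} {Q M R N Q' L L₁ L₂ P : List V}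
  {a b s u v h h₀ e x e₁ e₂ : V} {p q : V → Prop}

theorem DefX.deficient (h : DefX A p q L e) : Deficient p q L e := by
  obtain ⟨X, Y, h1, h2, h3, _⟩ := h
  exact ⟨X, Y, h1, h2, h3⟩

theorem exists_deficient {B E : Finset V} (hL : L.Nodup)
    (hB : ∀ c ∈ B, c ∈ A ∧
      ∃ e X Y, L = X ++ c :: e :: Y ∧ ¬ q e ∧ ∀ e' ∈ Y.head?, ¬ p e')
    (hE : ∀ e ∈ E, DefX A p q L e) :
    ∃ D : Finset V, D.card = B.card + E.card ∧ ∀ e ∈ D, Deficient p q L e := by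
  choose! hA f X Y hf using hB
  have hinj : Set.InjOn f B := by
    intro c hc c' hc' h
    have h1 : L = (X c ++ [c]) ++ f c :: Y c := by simpa using (hf c hc).1
    have h2 : L = (X c' ++ [c']) ++ f c :: Y c' := by rw [h]; simpa using (hf c' hc').1
    have := (split_unique hL h1 h2).1
    exact (List.append_singleton_inj.1 this).2
  refine ⟨B.image f ∪ E, ?_, ?_⟩
  · rw [Finset.card_union_of_disjoint, Finset.card_image_of_injOn hinj]
    rw [Finset.disjoint_left]
    intro e he heE
    obtain ⟨c, hc, rfl⟩ := Finset.mem_image.1 he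
    obtain ⟨X', Y', h1, _, _, h4⟩ := hE _ heE
    have h2 : L = (X c ++ [c]) ++ f c :: Y c := by simpa using (hf c hc).1
    obtain ⟨rfl, _⟩ := split_unique hL h2 h1
    exact h4 c (by simp) (hA c hc)
  · intro e he
    rcases Finset.mem_union.1 he with he | he
    · obtain ⟨c, hc, rfl⟩ := Finset.mem_image.1 he
      exact ⟨X c ++ [c], Y c, by simpa using (hf c hc).1, (hf c hc).2.1, (hf c hc).2.2⟩
    · exact (hE e he).deficient

theorem Pth.exists_succ (hL : Pth G a (L ++ M) v) (hx : x ∈ M) (hv : x ≠ v) :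
    ∃ X e Y, M = X ++ x :: e :: Y := by
  obtain ⟨X, Y, rfl⟩ := List.append_of_mem hx
  cases Y with
  | nil =>
    have := hL.2.2
    simp at this
    exact absurd this hv
  | cons e Y => exact ⟨X, e, Y, rfl⟩

namespace Cfg

theorem symm (c : Cfg G C A Q M R N a b u v) : Cfg G C A R N Q M b a v u where
  perm := List.perm_append_comm.trans c.perm
  pa := c.pb
  pb := c.pa
  ua := c.vb
  vb := c.ua
  neQ := c.neR
  neR := c.neQ
  avQ := c.avR
  avR := c.avQ
  hM := c.hN
  hN := c.hM
  uA := c.vA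
  vA := c.uA

theorem a_mem (c : Cfg G C A Q M R N a b u v) : a ∈ Q := by
  obtain ⟨T, hT⟩ := c.pa.exists_cons
  obtain ⟨y, Q, rfl⟩ := List.exists_cons_of_ne_nil c.neQ
  simp at hT
  simp [hT.1]

theorem exists_M (c : Cfg G C A Q M R N a b u v) : ∃ m M', M = m :: M' ∧ m ∈ A := by
  cases M with
  | nil => exact absurd c.vA (c.avQ v (by simpa using c.pa.last_mem))
  | cons m M => exact ⟨m, M, rfl, c.hM m (by simp)⟩

theorem exists_N (c : Cfg G C A Q M R N a b u v) : ∃ m N', N = m :: N' ∧ m ∈ A :=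
  c.symm.exists_M

theorem v_mem (c : Cfg G C A Q M R N a b u v) : v ∈ M := by
  have := c.pa.last_mem
  rcases List.mem_append.1 this with h | h
  · exact absurd c.vA (c.avQ v h)
  · exact h

theorem pb_long (c : Cfg G C A Q M R N a b u v) : Pth G b (R ++ N ++ (Q ++ M)) v :=
  c.pb.app c.ua c.pa

theorem perm_of (c : Cfg G C A Q M R N a b u v) (hQ : Q'.Perm Q) :
    (Q' ++ M ++ (R ++ N)).Perm C :=
  ((hQ.append_right M).append_right _).trans c.perm

theorem mirror (c : Cfg G C A Q M R N a b u v) :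
    ∃ a' b' u' v', Cfg G C A R.reverse M.reverse Q.reverse N.reverse a' b' u' v' ∧
      (∃ T, R = T ++ [a']) ∧ (∃ T, Q = T ++ [b']) ∧ M.head? = some v' ∧ N.head? = some u' := by
  obtain ⟨m, M, rfl, hm⟩ := c.exists_M
  obtain ⟨n, N, rfl, hn⟩ := c.exists_N
  obtain ⟨Q, a', rfl⟩ := exists_snoc_of_ne_nil c.neQ
  obtain ⟨R, b', rfl⟩ := exists_snoc_of_ne_nil c.neR
  refine ⟨b', a', n, m, ?_, ⟨_, rfl⟩, ⟨_, rfl⟩, by simp, by simp⟩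
  have p1 : Pth G a (Q ++ a' :: m :: M) v := by simpa using c.pa
  have p2 : Pth G b (R ++ b' :: n :: N) u := by simpa using c.pb
  have p1' : Pth G a ((Q ++ [a']) ++ m :: M) v := c.pa
  have p2' : Pth G b ((R ++ [b']) ++ n :: N) u := c.pb
  refine ⟨?_, ?_, ?_, p2.adj.symm, p1.adj.symm, by simp, by simp, ?_, ?_, ?_, ?_, hn, hm⟩
  · refine List.Perm.trans ?_ c.perm
    refine List.perm_iff_count.2 fun x => ?_
    simp only [List.count_append, List.count_reverse, List.count_cons, List.count_nil]
    omega
  · exact p2.take.rev.app c.vb.symm p1'.drop.rev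
  · exact p1.take.rev.app c.ua.symm p2'.drop.rev
  · exact fun x hx => c.avR x (List.mem_reverse.1 hx)
  · exact fun x hx => c.avQ x (List.mem_reverse.1 hx)
  · rw [List.head?_reverse]
    have := p1'.drop.2.2
    rw [this]
    simpa using c.vA
  · rw [List.head?_reverse]
    have := p2'.drop.2.2
    rw [this]
    simpa using c.uA

variable [Fintype V]

theorem ne (S : Sit G C H A) (c : Cfg G C A Q M R N a b u v) : u ≠ v := by
  have := List.nodup_append.1 (c.perm.nodup_iff.2 S.nodup)
  exact fun h => this.2.2 v (List.mem_append_right _ c.v_mem) u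
    (List.mem_append_right _ c.symm.v_mem) h.symm

theorem forced (S : Sit G C H A) (c : Cfg G C A Q M R N a b u v) (hQ : Q'.Perm Q)
    (hs : Pth G s (Q' ++ M) v) {B E : Finset V}
    (hB : ∀ x ∈ B, x ∈ A ∧ x ≠ u ∧ x ≠ v ∧ (∃ P, HLink G H 2 x P u) ∧ ∃ P, HLink G H 2 x P v)
    (hE : ∀ e ∈ E, Extra G A s b (Q' ++ M) (R ++ N) e) (hh : h ∈ H) :
    B.card + E.card + H.card ≤ deg G h := by
  have hperm := c.perm_of hQ
  have hnd := List.nodup_append.1 (hperm.nodup_iff.2 S.nodup)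
  have hsl : Pth G s (Q' ++ M ++ (R ++ N)) u := hs.app c.vb c.pb
  have hperm' : (R ++ N ++ (Q ++ M)).Perm C := List.perm_append_comm.trans c.perm
  obtain ⟨P, hP⟩ := S.lk u c.uA v c.vA (c.ne S)
  obtain ⟨D₁, hD₁, hD₁'⟩ := exists_deficient (A := A) (p := G.Adj s) (q := G.Adj b)
      (B := B.filter (· ∈ M))
      (E := E.filter (DefX A (G.Adj s) (G.Adj b) (Q' ++ M))) hnd.1 (by
    intro x hx
    obtain ⟨hx, hxM⟩ := Finset.mem_filter.1 hx
    obtain ⟨hxA, hxu, hxv, ⟨P₁, hP₁⟩, P₂, hP₂⟩ := hB x hx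
    obtain ⟨X, e, Y, rfl⟩ := hs.exists_succ hxM hxv
    refine ⟨hxA, e, Q' ++ X, Y, by simp, ?_, ?_⟩
    · refine S.single_cross (X := R ++ N ++ (Q ++ X)) (c := x) (F := []) (Y := Y) (u := v)
        (by simpa using c.pb_long) (by simpa using hperm') hP₂ ?_
      have := hP₂.2.2.2
      simp; omega
    · intro e' he'
      obtain ⟨Y, rfl⟩ : ∃ Y', Y = e' :: Y' := by cases Y <;> simp_all
      refine S.single_cross (X := Q' ++ X) (c := x) (F := [e]) (Y := Y ++ (R ++ N)) (u := u)
        (by simpa using hsl) (by simpa using hperm) hP₁ ?_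
      have := hP₁.2.2.2
      simp; omega) (by
    intro e he
    exact (Finset.mem_filter.1 he).2)
  obtain ⟨D₂, hD₂, hD₂'⟩ := exists_deficient (A := A) (p := G.Adj b) (q := G.Adj s)
      (B := B.filter (¬ · ∈ M))
      (E := E.filter (¬ DefX A (G.Adj s) (G.Adj b) (Q' ++ M) ·)) hnd.2.1 (by
    intro x hx
    obtain ⟨hx, hxM⟩ := Finset.mem_filter.1 hx
    obtain ⟨hxA, hxu, hxv, ⟨P₁, hP₁⟩, P₂, hP₂⟩ := hB x hx
    have hxN : x ∈ N := by
      have := c.perm.mem_iff.2 (S.sub x hxA)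
      simp only [List.mem_append] at this
      rcases this with (h | h) | h | h
      · exact absurd hxA (c.avQ x h)
      · exact absurd h hxM
      · exact absurd hxA (c.avR x h)
      · exact h
    obtain ⟨X, e, Y, rfl⟩ := c.pb.exists_succ hxN hxu
    refine ⟨hxA, e, R ++ X, Y, by simp, ?_, ?_⟩
    · refine S.single_cross (X := Q' ++ M ++ (R ++ X)) (c := x) (F := []) (Y := Y) (u := u)
        (by simpa using hsl) (by simpa using hperm) hP₁ ?_
      have := hP₁.2.2.2
      simp; omega
    · intro e' he'
      obtain ⟨Y, rfl⟩ : ∃ Y', Y = e' :: Y' := by cases Y <;> simp_all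
      refine S.single_cross (X := R ++ X) (c := x) (F := [e]) (Y := Y ++ (Q ++ M)) (u := v)
        (by simpa using c.pb_long) (by simpa using hperm') hP₂ ?_
      have := hP₂.2.2.2
      simp; omega) (by
    intro e he
    obtain ⟨he, he'⟩ := Finset.mem_filter.1 he
    exact (hE e he).resolve_left he')
  have hsA : s ∉ A := by
    refine c.avQ s (hQ.mem_iff.1 ?_)
    obtain ⟨T, hT⟩ := hs.exists_cons
    cases Q' with
    | nil => exact absurd hQ.symm.eq_nil c.neQ
    | cons x Q' => simp at hT; simp [hT.1]
  have := S.key hs c.pb hperm hP hsA (c.avR b c.symm.a_mem) hD₁' hD₂' hh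
  rw [hD₁, hD₂] at this
  have e1 := Finset.card_filter_add_card_filter_not (s := B) (· ∈ M)
  have e2 := Finset.card_filter_add_card_filter_not (s := E)
    (DefX A (G.Adj s) (G.Adj b) (Q' ++ M))
  omega

theorem forced_all (S : Sit2 G C H A h₀) (c : Cfg G C A Q M R N a b u v) (hQ : Q'.Perm Q)
    (hs : Pth G s (Q' ++ M) v) {E : Finset V}
    (hE : ∀ e ∈ E, Extra G A s b (Q' ++ M) (R ++ N) e) (hh : h ∈ H) :
    A.card + E.card + H.card ≤ deg G h + 2 := by
  have h1 := c.forced S.toSit hQ hs (B := (A.erase u).erase v) (by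
    intro x hx
    simp only [Finset.mem_erase] at hx
    exact ⟨hx.2.2, hx.2.1, hx.1, S.lk2 x hx.2.2 u c.uA hx.2.1, S.lk2 x hx.2.2 v c.vA hx.1⟩)
    hE hh
  have h2 := Finset.card_erase_add_one c.uA
  have h3 := Finset.card_erase_add_one (Finset.mem_erase.2 ⟨(c.ne S.toSit).symm, c.vA⟩)
  omega

theorem extra_unique (S : Sit2 G C H A h₀) (c : Cfg G C A Q M R N a b u v) (hQ : Q'.Perm Q)
    (hs : Pth G s (Q' ++ M) v) (h₁ : Extra G A s b (Q' ++ M) (R ++ N) e₁)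
    (h₂ : Extra G A s b (Q' ++ M) (R ++ N) e₂) : e₁ = e₂ := by
  by_contra hne
  have h1 := c.forced_all S hQ hs (E := {e₁, e₂}) (by
    intro e he
    rcases Finset.mem_insert.1 he with rfl | he
    · exact h₁
    · exact Finset.mem_singleton.1 he ▸ h₂) S.h₀_mem
  have h2 := S.deg_add_one_le S.h₀_mem
  have h3 := Finset.card_filter_le A (fun x => G.Adj h₀ x)
  rw [Finset.card_pair hne] at h1
  omega

end Cfg

end Forced

section Crossing

variable {G : SimpleGraph V} {C : List V} {H A : Finset V}
  {Q M R N Q' L L₁ L₂ P W R₁ R₂ Q₁ Q₂ X Y Z T lost : List V}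
  {a b a' s s' u v h h₀ e x z zp w p₁ q₁ m : V} {n : ℕ}

theorem Cfg.pth_start (c : Cfg G C A (Q₁ ++ Q₂) M R N a b u v) (hX : Pth G a Q₁ s)
    (hw : Q₂ ++ M = w :: T) (haw : G.Adj a w) : Pth G s (Q₁.reverse ++ Q₂ ++ M) v := by
  have h1 := c.pa
  obtain ⟨X, hX'⟩ := hX.exists_snoc
  have h2 : Pth G a (Q₁ ++ w :: T) v := by rw [← hw]; simpa using h1
  have := hX.rev.app haw h2.drop
  rw [← hw] at this
  simpa using this

variable [Fintype V]

theorem Sit.no_insertion (S : Sit G C H A) (h₁ : Pth G b (R₁ ++ [z]) z) (hW : OutList C H W)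
    (hz : Link G z W a) (hX : Pth G a X s) (hs : G.Adj s zp) (hY : Pth G zp Y u)
    (hP : HLink G H n u P p₁) (hZ : Pth G p₁ Z q₁) (hq : G.Adj q₁ b)
    (hC : (R₁ ++ z :: Y ++ (X ++ Z) ++ lost).Perm C) (hl : lost.length < P.length) : False := by
  have := h₁.link hz (hX.app hs (hY.link hP.1 hZ))
  refine S.no_longer (E := P ++ W) (lost := lost) this hq ?_ hC (nodup_ext hP hW)
    (S.ext_notMem hP hW) (by simp; omega)
  refine List.perm_iff_count.2 fun x => ?_
  simp only [List.count_append, List.count_cons, List.count_nil]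
  omega

namespace Cfg

/-- After a crossing from `a` to `z`, the vertex `b` misses both vertices following `z`. -/
theorem not_adj_next (S : Sit2 G C H A h₀) (c : Cfg G C A Q M (R₁ ++ z :: R₂) N a b u v)
    (hzp : R₂ ++ N = zp :: Y) (hz : Cross G C H a z) :
    ¬ G.Adj b zp ∧ ∀ y ∈ Y.head?, ¬ G.Adj b y := by
  obtain ⟨W, hW, hW'⟩ := hz
  obtain ⟨P, hP⟩ := S.lk2 v c.vA u c.uA (c.ne S.toSit).symm
  have hPl := hP.2.2.2
  have e1 : R₁ ++ z :: R₂ ++ N = R₁ ++ z :: zp :: Y := by simp [hzp]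
  have hp := c.symm.perm
  have hb := c.pb
  rw [e1] at hp hb
  refine ⟨S.pair_cross (F := []) hb c.pa hp hP hW hW' (by simp; omega), ?_⟩
  intro y hy
  obtain ⟨Y, rfl⟩ : ∃ Y', Y = y :: Y' := by cases Y <;> simp_all
  exact S.pair_cross (F := [zp]) hb c.pa hp hP hW hW' (by simp; omega)

theorem insertion (S : Sit2 G C H A h₀) (c : Cfg G C A (Q₁ ++ Q₂) M (R₁ ++ z :: R₂) N a b u v)
    (hzp : R₂ ++ N = zp :: Y) (hz : Cross G C H a z) (hX : Pth G a Q₁ s)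
    (hw : Q₂ ++ M = w :: T) (haw : G.Adj a w) (hZ : Pth G p₁ Z q₁) (hq : G.Adj q₁ b)
    (hp₁ : p₁ ∈ A) (hne : p₁ ≠ u) (hl : lost.length ≤ 1)
    (hp : (Q₁ ++ Z ++ lost).Perm (Q₁ ++ Q₂ ++ M)) :
    G.Adj s z ∧ ¬ G.Adj s zp ∧ ¬ G.Adj a zp := by
  obtain ⟨P, hP⟩ := S.lk2 u c.uA p₁ hp₁ hne.symm
  have hPl := hP.2.2.2
  have e1 : R₁ ++ z :: R₂ ++ N = R₁ ++ z :: zp :: Y := by simp [hzp]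
  have hb := c.pb
  have hperm := c.perm
  rw [e1] at hb hperm
  have hY : Pth G zp (zp :: Y) u := by
    have : Pth G b ((R₁ ++ [z]) ++ zp :: Y) u := by simpa using hb
    exact this.drop
  have hnd := (List.nodup_append.1 (hperm.nodup_iff.2 S.nodup)).2.1
  have hbz := c.not_adj_next S hzp hz
  have hs := c.pth_start hX hw haw
  have hperm' : ∀ X' : List V, X'.Perm Q₁ →
      (R₁ ++ z :: zp :: Y ++ (X' ++ Z) ++ lost).Perm C := by
    intro X' hX'
    refine List.Perm.trans (List.perm_iff_count.2 fun x => ?_) hperm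
    have h1 := hp.count_eq x
    have h2 := hX'.count_eq x
    simp only [List.count_append, List.count_cons] at *
    omega
  have h1 : ¬ G.Adj s zp := by
    intro hszp
    obtain ⟨W, hW, hW'⟩ := hz
    exact S.no_insertion hb.take hW.rev hW'.rev hX hszp hY hP hZ hq
      (hperm' _ (List.Perm.refl _)) (by omega)
  have h2 : G.Adj s z := by
    by_contra hsz
    have hE : ∀ e, DefX A (G.Adj b) (G.Adj s) (R₁ ++ z :: R₂ ++ N) e →
        Extra G A s b (Q₁.reverse ++ Q₂ ++ M) (R₁ ++ z :: R₂ ++ N) e := fun e => Or.inr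
    have := c.extra_unique S ((List.reverse_perm Q₁).append_right Q₂) hs
      (hE z ⟨R₁, zp :: Y, e1, hsz, by simpa using hbz.1, fun x hx => c.avR x (by simp [hx])⟩)
      (hE zp ⟨R₁ ++ [z], Y, by simp [e1], h1, hbz.2, fun x hx => c.avR x (by
        simp at hx ⊢; tauto)⟩)
    subst this
    simp [List.nodup_append] at hnd
  refine ⟨h2, h1, fun h3 => ?_⟩
  exact S.no_insertion hb.take outList_nil (link_nil.2 h2.symm) hX.rev h3 hY hP hZ hq
    (hperm' _ (List.reverse_perm _)) (by omega)

/-- `b` is not adjacent to the vertex following `a`. -/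
theorem not_adj_second (S : Sit2 G C H A h₀) (c : Cfg G C A Q M R N a b u v)
    (hx : Q ++ M = a :: x :: T) : ¬ G.Adj b x := by
  obtain ⟨P, hP⟩ := S.lk2 u c.uA v c.vA (c.ne S.toSit)
  have hPl := hP.2.2.2
  obtain ⟨N', hN'⟩ := c.pb.exists_snoc
  have h1 := c.pb_long
  have h2 := c.symm.perm
  rw [hx, hN'] at h1 h2
  exact S.single_cross (X := N') (c := u) (F := [a]) (Y := T) (u := v) (by simpa using h1)
    (by simpa using h2) hP (by simp; omega)

theorem not_adj_ab (S : Sit G C H A) (c : Cfg G C A Q M R N a b u v) : ¬ G.Adj b a := by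
  obtain ⟨P, hP⟩ := S.lk u c.uA v c.vA (c.ne S)
  exact fun h => S.pair_unlinked c.pa c.pb c.perm hP outList_nil (link_nil.2 h.symm)

/-- `a` is not adjacent to the vertex following an attachment on the first path. -/
theorem not_adj_succ (S : Sit G C H A) (c : Cfg G C A Q M R N a b u v) (hm : m ∈ A)
    (h : Q ++ M = X ++ m :: e :: Y) : ¬ G.Adj a e := by
  have hmu : m ≠ u := by
    rintro rfl
    have h1 : m ∈ Q ++ M := by simp [h]
    exact (List.nodup_append.1 (c.perm.nodup_iff.2 S.nodup)).2.2 _ h1 _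
      (List.mem_append_right _ c.symm.v_mem) rfl
  obtain ⟨P, hP⟩ := S.lk m hm u c.uA hmu
  have hPl := hP.2.2.2
  have h1 := c.symm.pb_long
  have h2 := c.perm
  rw [h] at h1 h2
  exact S.single_cross (X := X) (c := m) (F := []) (Y := Y ++ (R ++ N)) (u := u)
    (by simpa using h1) (by simpa using h2) hP (by simp; omega)

/-- The block `Q` together with the attachment following it, cut at the first neighbour of `b`. -/
theorem split_first (S : Sit2 G C H A h₀) (c : Cfg G C A Q M R N a b u v)
    (hM : M = m :: T) (hb : ∃ x ∈ Q ++ [m], G.Adj b x) :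
    ∃ X x Y, Q ++ M = X ++ x :: Y ∧ G.Adj b x ∧ (∀ y ∈ X, ¬ G.Adj b y) ∧
      (∃ Q₂, Q = X ++ Q₂) ∧ 2 ≤ X.length := by
  obtain ⟨x₀, hx₀, hbx₀⟩ := hb
  rcases exists_first (G.Adj b) (Q ++ [m]) with h1 | ⟨X, x, Y, h1, h2, h3⟩
  · exact absurd hbx₀ (h1 x₀ hx₀)
  have e1 : Q ++ M = X ++ x :: (Y ++ T) := by
    have : Q ++ M = Q ++ [m] ++ T := by simp [hM]
    rw [this, h1]; simp
  refine ⟨X, x, Y ++ T, e1, h2, h3, ?_, ?_⟩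
  · rcases List.eq_nil_or_concat Y with rfl | ⟨Y', y, rfl⟩
    · exact ⟨[], by simpa using (List.append_inj' h1 rfl).1⟩
    · have h4 : Q ++ [m] = (X ++ x :: Y') ++ [y] := by simpa using h1
      exact ⟨x :: Y', (List.append_inj' h4 rfl).1⟩
  · have hpa := c.pa
    rw [e1] at hpa
    obtain ⟨T', hT'⟩ := hpa.exists_cons
    match X, e1, hT' with
    | [], _, hT' =>
      simp at hT'
      exact absurd (hT'.1 ▸ h2) (c.not_adj_ab S.toSit)
    | [y], e1, hT' =>
      simp at hT'
      obtain ⟨rfl, _⟩ := hT'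
      exact absurd h2 (c.not_adj_second S (by simpa using e1))
    | _ :: _ :: _, _, _ => simp

end Cfg

end Crossing

section NoCrossing

variable [Fintype V] {G : SimpleGraph V} {C : List V} {H A : Finset V}
  {Q M R N L P R₁ R₂ R₃ Q₁ Q₂ X Y T : List V} {a b s u v h h₀ e x z zp w m : V}

namespace Cfg

theorem extra_unique' (S : Sit2 G C H A h₀) (c : Cfg G C A Q M R N a b u v) {e₁ e₂ : V}
    (h₁ : Extra G A a b (Q ++ M) (R ++ N) e₁)
    (h₂ : Extra G A a b (Q ++ M) (R ++ N) e₂) : e₁ = e₂ :=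
  c.extra_unique S (List.Perm.refl _) c.pa h₁ h₂

theorem nodup_left (S : Sit G C H A) (c : Cfg G C A Q M R N a b u v) : (Q ++ M).Nodup :=
  (List.nodup_append.1 (c.perm.nodup_iff.2 S.nodup)).1

theorem not_adj_of_cross (S : Sit2 G C H A h₀) (c : Cfg G C A Q M (R₁ ++ z :: R₂) N a b u v)
    (hzp : R₂ ++ N = zp :: Y) (hz : Cross G C H a z) : ¬ G.Adj a zp := by
  obtain ⟨m, M', hM, hm⟩ := c.exists_M
  by_cases hb : ∃ x ∈ Q ++ [m], G.Adj b x
  · obtain ⟨X, x, Y', e1, hbx, hX, ⟨Q₂, rfl⟩, hlen⟩ := c.split_first S hM hb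
    have e2 : Q₂ ++ M = x :: Y' := by simpa using e1
    have hpa := c.pa
    have hnd := c.nodup_left S.toSit
    rw [e1] at hpa hnd
    obtain ⟨X₀, e, rfl⟩ := exists_snoc_of_ne_nil (l := X) (by rintro rfl; simp at hlen)
    have hvx := hpa.drop.rev
    have hvu := (c.ne S.toSit).symm
    by_cases hax : G.Adj a x
    · have hX₀ : Pth G a (X₀ ++ [e]) e := by
        have : Pth G a (X₀ ++ e :: x :: Y') v := by simpa using hpa
        exact this.take
      refine (c.insertion S hzp hz hX₀ e2 hax hvx hbx.symm c.vA hvu (lost := []) (by simp)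
        ?_).2.2
      rw [e1, List.append_nil]
      exact (List.reverse_perm _).append_left _
    · obtain ⟨X₁, s, rfl⟩ := exists_snoc_of_ne_nil (l := X₀) (by rintro rfl; simp at hlen)
      have hav : ∀ y ∈ X₁ ++ [s] ++ [e], y ∉ A := fun y hy =>
        c.avQ y (List.mem_append_left _ hy)
      have he : Extra G A a b (X₁ ++ [s] ++ [e] ++ Q₂ ++ M) (R₁ ++ z :: R₂ ++ N) e :=
        Or.inl ⟨X₁ ++ [s], x :: Y', by rw [e1]; simp, hX e (by simp), by simpa using hax,
          fun y hy => hav y (List.mem_append_left _ hy)⟩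
      have hpa' : Pth G a (X₁ ++ s :: e :: x :: Y') v := by simpa using hpa
      by_cases hae : G.Adj a e
      · have c' : Cfg G C A ((X₁ ++ [s]) ++ (e :: Q₂)) M (R₁ ++ z :: R₂) N a b u v := by
          simpa using c
        refine (c'.insertion S hzp hz hpa'.take (T := x :: Y') (by simp [e2]) hae hvx hbx.symm
          c.vA hvu (lost := [e]) (by simp) ?_).2.2
        have : X₁ ++ [s] ++ e :: Q₂ ++ M = X₁ ++ [s] ++ e :: x :: Y' := by simp [e2]
        rw [this]
        refine List.perm_iff_count.2 fun x => ?_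
        simp only [List.count_append, List.count_reverse, List.count_cons, List.count_nil]
        omega
      · have hs : Extra G A a b (X₁ ++ [s] ++ [e] ++ Q₂ ++ M) (R₁ ++ z :: R₂ ++ N) s :=
          Or.inl ⟨X₁, e :: x :: Y', by rw [e1]; simp, hX s (by simp), by simpa using hae,
            fun y hy => hav y (by simp [hy])⟩
        have := c.extra_unique' S he hs
        subst this
        simp [List.nodup_append] at hnd
  · push Not at hb
    subst hM
    obtain ⟨Q₀, q, hQ⟩ := exists_snoc_of_ne_nil c.neQ
    have hm' : Extra G A a b (Q ++ m :: M') (R₁ ++ z :: R₂ ++ N) m := by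
      refine Or.inl ⟨Q, M', rfl, hb m (by simp), ?_, c.avQ⟩
      intro e' he'
      obtain ⟨Y', rfl⟩ : ∃ Y', M' = e' :: Y' := by cases M' <;> simp_all
      exact c.not_adj_succ S.toSit hm rfl
    have hpa : Pth G a (Q₀ ++ q :: m :: M') v := by simpa [hQ] using c.pa
    by_cases ham : G.Adj a m
    · have c' : Cfg G C A (Q ++ []) (m :: M') (R₁ ++ z :: R₂) N a b u v := by simpa using c
      refine (c'.insertion S hzp hz (s := q) (by simpa [hQ] using hpa.take) rfl ham c.pa.drop c.vb
        hm ?_ (lost := []) (by simp) (by simp)).2.2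
      rintro rfl
      exact (List.nodup_append.1 (c.perm.nodup_iff.2 S.nodup)).2.2 m (by simp) m
        (List.mem_append_right _ c.symm.v_mem) rfl
    · have hq : Extra G A a b (Q ++ m :: M') (R₁ ++ z :: R₂ ++ N) q :=
        Or.inl ⟨Q₀, m :: M', by simp [hQ], hb q (by simp [hQ]), by simpa using ham,
          fun y hy => c.avQ y (by simp [hQ, hy])⟩
      have := c.extra_unique' S hm' hq
      have hnd := c.nodup_left S.toSit
      rw [hQ, this] at hnd
      simp [List.nodup_append] at hnd

theorem extra_next (S : Sit2 G C H A h₀) (c : Cfg G C A Q M (R₁ ++ z :: R₂) N a b u v)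
    (hzp : R₂ ++ N = zp :: Y) (hz : Cross G C H a z) :
    Extra G A a b (Q ++ M) (R₁ ++ z :: R₂ ++ N) zp := by
  refine Or.inr ⟨R₁ ++ [z], Y, by simp [hzp], c.not_adj_of_cross S hzp hz,
    (c.not_adj_next S hzp hz).2, fun x hx => c.avR x (by simp at hx ⊢; tauto)⟩

/-- The structure forced by a crossing from `a` to `z`. -/
theorem of_cross (S : Sit2 G C H A h₀) (c : Cfg G C A Q M (R₁ ++ z :: R₂) N a b u v)
    (hzp : R₂ ++ N = zp :: Y) (hz : Cross G C H a z) :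
    G.Adj a z ∧ ∃ Q₁ Q₂ s x T, Q = Q₁ ++ Q₂ ∧ Pth G a Q₁ s ∧ 2 ≤ Q₁.length ∧
      Q₂ ++ M = x :: T ∧ G.Adj b x ∧ G.Adj a x ∧ G.Adj s z ∧ ¬ G.Adj s zp := by
  have hx := c.extra_next S hzp hz
  have hnd := c.perm.nodup_iff.2 S.nodup
  have hnd2 := (List.nodup_append.1 hnd).2.1
  have e0 : R₁ ++ z :: R₂ ++ N = R₁ ++ z :: zp :: Y := by simp [hzp]
  have hzpR : zp ∈ R₁ ++ z :: R₂ ++ N := by simp [e0]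
  have hdisj : ∀ y ∈ Q ++ M, y ≠ zp := fun y hy =>
    (List.nodup_append.1 hnd).2.2 y hy zp hzpR
  have haz : G.Adj a z := by
    by_contra haz
    have : Extra G A a b (Q ++ M) (R₁ ++ z :: R₂ ++ N) z :=
      Or.inr ⟨R₁, zp :: Y, e0, haz, by simpa using (c.not_adj_next S hzp hz).1,
        fun x hx => c.avR x (by simp [hx])⟩
    have := c.extra_unique' S hx this
    rw [e0, this] at hnd2
    simp [List.nodup_append] at hnd2
  refine ⟨haz, ?_⟩
  obtain ⟨m, M', hM, hm⟩ := c.exists_M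
  have hbm : G.Adj b m := by
    by_contra hbm
    subst hM
    have hm' : Extra G A a b (Q ++ m :: M') (R₁ ++ z :: R₂ ++ N) m := by
      refine Or.inl ⟨Q, M', rfl, hbm, ?_, c.avQ⟩
      intro e' he'
      obtain ⟨Y', rfl⟩ : ∃ Y', M' = e' :: Y' := by cases M' <;> simp_all
      exact c.not_adj_succ S.toSit hm rfl
    exact hdisj m (by simp) (c.extra_unique' S hm' hx)
  obtain ⟨X, x, Y', e1, hbx, hX, ⟨Q₂, rfl⟩, hlen⟩ := c.split_first S hM ⟨m, by simp, hbm⟩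
  have e2 : Q₂ ++ M = x :: Y' := by simpa using e1
  have hpa := c.pa
  rw [e1] at hpa
  obtain ⟨X₀, s, rfl⟩ := exists_snoc_of_ne_nil (l := X) (by rintro rfl; simp at hlen)
  have hax : G.Adj a x := by
    by_contra hax
    have : Extra G A a b (X₀ ++ [s] ++ Q₂ ++ M) (R₁ ++ z :: R₂ ++ N) s :=
      Or.inl ⟨X₀, x :: Y', by rw [e1]; simp, hX s (by simp), by simpa using hax,
        fun y hy => c.avQ y (by simp [hy])⟩
    exact hdisj s (by simp) (c.extra_unique' S this hx)
  have hX₀ : Pth G a (X₀ ++ [s]) s := by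
    have : Pth G a (X₀ ++ s :: x :: Y') v := by simpa using hpa
    exact this.take
  have := c.insertion S hzp hz hX₀ e2 hax hpa.drop.rev hbx.symm c.vA (c.ne S.toSit).symm
    (lost := []) (by simp) (by
      rw [e1, List.append_nil]
      exact (List.reverse_perm _).append_left _)
  exact ⟨_, Q₂, s, x, Y', rfl, hX₀, hlen, e2, hbx, hax, this.1, this.2.1⟩

end Cfg

end NoCrossing

section DegreeBounds

variable {G : SimpleGraph V} {C : List V} {H A : Finset V}
  {L P X Y : List V} {a c e u h x z zp w : V}

theorem idxOf_of_split {l : List V} (hl : l.Nodup) (h : l = X ++ x :: Y) :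
    l.idxOf x = X.length := by
  subst h
  have : x ∉ X := fun hx => (List.nodup_append.1 hl).2.2 x hx x (by simp) rfl
  rw [List.idxOf_append_of_notMem this]
  simp

variable [Fintype V]

theorem Sit.adj_of_card_le (S : Sit G C H A) (hh : h ∈ H) (hd : A.card + H.card ≤ deg G h + 1) :
    (∀ x ∈ H, x ≠ h → G.Adj h x) ∧ ∀ x ∈ A, G.Adj h x := by
  have h1 : (G.neighborSet h).toFinset ⊆ H.erase h ∪ A := by
    intro y hy
    have hy : G.Adj h y := by simpa using hy
    rcases S.closed h hh y hy with hyH | hyA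
    · simp [hyH, hy.ne']
    · simp [hyA]
  have h2 := Finset.card_union_le (H.erase h) A
  have h3 := Finset.card_erase_add_one hh
  rw [deg, Set.ncard_eq_toFinset_card'] at hd
  have h4 := Finset.eq_of_subset_of_card_le h1 (by omega)
  have h5 : ∀ x, x ∈ H.erase h ∪ A → G.Adj h x := by
    intro x hx
    rw [← h4] at hx
    simpa using hx
  exact ⟨fun x hx hne => h5 x (by simp [hx, hne]), fun x hx => h5 x (by simp [hx])⟩

theorem Sit.succ_notMem (S : Sit G C H A) (hL : Pth G a (X ++ c :: e :: Y) u) (hu : G.Adj u a)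
    (hp : (X ++ c :: e :: Y).Perm C) (hc : c ∈ A) (he : e ∈ A) : False := by
  obtain ⟨P, hP⟩ := S.lk c hc e he hL.adj.ne
  have hL' : Pth G a ((X ++ [c]) ++ e :: Y) u := by simpa using hL
  refine S.no_longer (E := P) (lost := []) (hL.take.link hP.1 hL'.drop) hu ?_ hp hP.2.1
    (S.notMem hP) (by have := hP.2.2.2; simp; omega)
  refine List.perm_iff_count.2 fun x => ?_
  simp only [List.count_append, List.count_cons, List.count_nil]
  omega

theorem Sit.deg_bound (S : Sit G C H A) (hL : Pth G a L u) (hu : G.Adj u a) (hp : L.Perm C)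
    (huA : u ∈ A) (haA : a ∉ A) (hlk : ∀ x ∈ A, x ≠ u → ∃ P, HLink G H 2 x P u)
    (hz : L = X ++ z :: zp :: w :: Y) (hzA : z ∉ A) (hzpA : zp ∉ A) (haz : G.Adj a z)
    (hazp : ¬ G.Adj a zp) (haw : ¬ G.Adj a w) :
    deg G a + 2 * A.card + H.card + 1 ≤ Fintype.card V := by
  have hnd := hp.nodup_iff.2 S.nodup
  have hsucc : ∀ c ∈ A.erase u, c ∈ A ∧ ∃ e g X Y, L = X ++ c :: e :: g :: Y ∧ e ∉ A ∧
      ¬ G.Adj a e ∧ ¬ G.Adj a g := by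
    intro c hc
    obtain ⟨hcu, hcA⟩ := Finset.mem_erase.1 hc
    have hcL : c ∈ L := hp.mem_iff.2 (S.sub c hcA)
    obtain ⟨X, e, Y, rfl⟩ := Pth.exists_succ (L := []) hL hcL hcu
    have heA : e ∉ A := fun he => S.succ_notMem hL hu hp hcA he
    have heu : e ≠ u := fun h => heA (h ▸ huA)
    cases Y with
    | nil =>
      have := hL.2.2
      simp at this
      exact absurd this heu
    | cons g Y =>
      obtain ⟨P, hP⟩ := hlk c hcA hcu
      have hPl := hP.2.2.2
      exact ⟨hcA, e, g, X, Y, rfl, heA,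
        S.single_cross (F := []) hL hp hP (by simp; omega),
        S.single_cross (F := [e]) hL hp hP (by simp; omega)⟩
  choose! hA f g X' Y' hf hfA haf hag using hsucc
  set pos : V → ℕ := fun x => L.idxOf x with hpos
  have hinj : ∀ x ∈ L, ∀ y, pos x = pos y → x = y := fun x hx y h => (List.idxOf_inj hx).1 h
  have p0 : ∀ c ∈ A.erase u, pos c = (X' c).length ∧ pos (f c) = (X' c).length + 1 ∧
      pos (g c) = (X' c).length + 2 ∧ c ∈ L ∧ f c ∈ L ∧ g c ∈ L := by
    intro c hc
    have h1 := hf c hc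
    refine ⟨idxOf_of_split hnd h1, ?_, ?_, ?_, ?_, ?_⟩
    · rw [hpos]; simpa using idxOf_of_split (X := X' c ++ [c]) hnd (by simpa using h1)
    · rw [hpos]; simpa using idxOf_of_split (X := X' c ++ [c, f c]) hnd (by simpa using h1)
    all_goals rw [h1]; simp
  have pz : pos z = X.length := idxOf_of_split hnd hz
  have pzp : pos zp = X.length + 1 := by
    rw [hpos]; simpa using idxOf_of_split (X := X ++ [z]) hnd (by simpa using hz)
  have pw : pos w = X.length + 2 := by
    rw [hpos]; simpa using idxOf_of_split (X := X ++ [z, zp]) hnd (by simpa using hz)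
  have pa : pos a = 0 := by
    obtain ⟨T, rfl⟩ := hL.exists_cons
    simp [hpos]
  have hzL : z ∈ L ∧ zp ∈ L ∧ w ∈ L := by rw [hz]; simp
  have i1 : Set.InjOn f (A.erase u : Finset V) := by
    intro c hc c' hc' h
    have q1 := p0 c hc
    have q2 := p0 c' hc'
    refine hinj c q1.2.2.2.1 c' ?_
    rw [h] at q1
    omega
  have i2 : Set.InjOn g (A.erase u : Finset V) := by
    intro c hc c' hc' h
    have q1 := p0 c hc
    have q2 := p0 c' hc'
    refine hinj c q1.2.2.2.1 c' ?_
    rw [h] at q1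
    omega
  have d1 : Disjoint ((A.erase u).image f) ((A.erase u).image g) := by
    rw [Finset.disjoint_left]
    intro x hx hx'
    obtain ⟨c, hc, rfl⟩ := Finset.mem_image.1 hx
    obtain ⟨c', hc', h⟩ := Finset.mem_image.1 hx'
    have q1 := p0 c hc
    have q2 := p0 c' hc'
    rw [h] at q2
    have : c = f c' := hinj c q1.2.2.2.1 _ (by omega)
    exact hfA c' hc' (this ▸ hA c hc)
  have d2 : Disjoint ((A.erase u).image f ∪ (A.erase u).image g) {a, zp, w} := by
    rw [Finset.disjoint_left]
    intro x hx hx'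
    rcases Finset.mem_union.1 hx with hx | hx
    · obtain ⟨c, hc, rfl⟩ := Finset.mem_image.1 hx
      have q1 := p0 c hc
      simp only [Finset.mem_insert, Finset.mem_singleton] at hx'
      rcases hx' with h | h | h
      · rw [h] at q1; omega
      · rw [h] at q1
        have : c = z := hinj c q1.2.2.2.1 _ (by omega)
        exact hzA (this ▸ hA c hc)
      · rw [h] at q1
        have : c = zp := hinj c q1.2.2.2.1 _ (by omega)
        exact hzpA (this ▸ hA c hc)
    · obtain ⟨c, hc, rfl⟩ := Finset.mem_image.1 hx
      have q1 := p0 c hc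
      simp only [Finset.mem_insert, Finset.mem_singleton] at hx'
      rcases hx' with h | h | h
      · rw [h] at q1; omega
      · rw [h] at q1
        have : f c = z := hinj _ q1.2.2.2.2.1 _ (by omega)
        exact haf c hc (this ▸ haz)
      · rw [h] at q1
        have : c = z := hinj c q1.2.2.2.1 _ (by omega)
        exact hzA (this ▸ hA c hc)
  have d3 : Disjoint ((A.erase u).image f ∪ (A.erase u).image g ∪ {a, zp, w}) H := by
    rw [Finset.disjoint_left]
    intro x hx hxH
    refine S.disj x hxH (hp.mem_iff.1 ?_)
    simp only [Finset.mem_union, Finset.mem_image, Finset.mem_insert,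
      Finset.mem_singleton] at hx
    rcases hx with (⟨c, hc, rfl⟩ | ⟨c, hc, rfl⟩) | rfl | rfl | rfl
    · exact (p0 c (by simpa using hc)).2.2.2.2.1
    · exact (p0 c (by simpa using hc)).2.2.2.2.2
    · exact hL.head_mem
    · exact hzL.2.1
    · exact hzL.2.2
  have d4 : Disjoint ((A.erase u).image f ∪ (A.erase u).image g ∪ {a, zp, w} ∪ H)
      (G.neighborSet a).toFinset := by
    rw [Finset.disjoint_left]
    intro x hx hxN
    have hxN : G.Adj a x := by simpa using hxN
    rcases Finset.mem_union.1 hx with hx | hx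
    · simp only [Finset.mem_union, Finset.mem_image, Finset.mem_insert,
        Finset.mem_singleton] at hx
      rcases hx with (⟨c, hc, rfl⟩ | ⟨c, hc, rfl⟩) | rfl | rfl | rfl
      · exact haf c (by simpa using hc) hxN
      · exact hag c (by simpa using hc) hxN
      · exact hxN.ne rfl
      · exact hazp hxN
      · exact haw hxN
    · exact S.not_adj (hp.mem_iff.1 hL.head_mem) haA hx hxN
  have c3 : ({a, zp, w} : Finset V).card = 3 := by
    rw [Finset.card_eq_three]
    refine ⟨a, zp, w, ?_, ?_, ?_, rfl⟩ <;> intro h <;> simp only [h] at * <;> omega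
  have := Finset.card_le_univ ((A.erase u).image f ∪ (A.erase u).image g ∪ {a, zp, w} ∪ H ∪
      (G.neighborSet a).toFinset)
  rw [Finset.card_union_of_disjoint d4, Finset.card_union_of_disjoint d3,
    Finset.card_union_of_disjoint d2, Finset.card_union_of_disjoint d1,
    Finset.card_image_of_injOn i1, Finset.card_image_of_injOn i2, c3,
    ← Set.ncard_eq_toFinset_card'] at this
  have h6 := Finset.card_erase_add_one huA
  rw [deg]
  omega

end DegreeBounds

section NoCrossing

variable [Fintype V] {G : SimpleGraph V} {C : List V} {H A : Finset V}
  {Q M R N L P R₁ R₂ R₃ Q₁ Q₂ X Y T : List V} {a b s u v h h₀ e w x y z zp : V}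

namespace Cfg

/-- In the situation of `of_cross`, the vertex two steps after `z` is joined neither to `s` nor
to `a`. -/
theorem not_adj_skip (S : Sit2 G C H A h₀)
    (c : Cfg G C A (Q₁ ++ Q₂) M (R₁ ++ z :: zp :: R₃) N a b u v)
    (hw : R₃ ++ N = w :: Y) (haz : G.Adj a z) (hX : Pth G a Q₁ s) (hx : Q₂ ++ M = x :: T)
    (hbx : G.Adj b x) (hsz : G.Adj s z) : ¬ G.Adj s w ∧ ¬ G.Adj a w := by
  obtain ⟨P, hP⟩ := S.lk2 u c.uA v c.vA (c.ne S.toSit)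
  have hPl := hP.2.2.2
  have e1 : R₁ ++ z :: zp :: R₃ ++ N = R₁ ++ z :: zp :: w :: Y := by simp [hw]
  have hb := c.pb
  have hperm := c.perm
  have hpa := c.pa
  have e2 : Q₁ ++ Q₂ ++ M = Q₁ ++ x :: T := by simp [hx]
  rw [e1] at hb hperm
  rw [e2] at hpa hperm
  have hY : Pth G w (w :: Y) u := by
    have : Pth G b ((R₁ ++ [z, zp]) ++ w :: Y) u := by simpa using hb
    exact this.drop
  have hperm' : ∀ X' : List V, X'.Perm Q₁ →
      (R₁ ++ z :: w :: Y ++ (X' ++ (x :: T).reverse) ++ [zp]).Perm C := by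
    intro X' hX'
    refine List.Perm.trans (List.perm_iff_count.2 fun y => ?_) hperm
    have h2 := hX'.count_eq y
    simp only [List.count_append, List.count_cons, List.count_reverse, List.count_nil] at *
    omega
  constructor
  · intro h
    exact S.no_insertion hb.take outList_nil (link_nil.2 haz.symm) hX h hY hP hpa.drop.rev
      hbx.symm (hperm' _ (List.Perm.refl _)) (by simp; omega)
  · intro h
    exact S.no_insertion hb.take outList_nil (link_nil.2 hsz.symm) hX.rev h hY hP hpa.drop.rev
      hbx.symm (hperm' _ (List.reverse_perm _)) (by simp; omega)

/-- The cycle obtained by bypassing two vertices of `R` through `H`. -/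
theorem bypass (S : Sit G C H A) (c : Cfg G C A Q M R N a b u v)
    (hR : R ++ N = R₁ ++ z :: zp :: w :: x :: Y) (haz : G.Adj a z) (hbx : G.Adj b x)
    (hP : HLink G H 0 u P v) :
    P.length ≤ 2 ∧ ∃ L, Pth G a L z ∧ L.length + 2 = C.length + P.length ∧ L.Nodup ∧
      zp ∉ L ∧ w ∉ L := by
  have hb := c.pb
  have hperm := c.perm
  rw [hR] at hb hperm
  have hY : Pth G x (x :: Y) u := by
    have : Pth G b ((R₁ ++ [z, zp, w]) ++ x :: Y) u := by simpa using hb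
    exact this.drop
  have hL := c.pa.link hP.rev.1 (hY.rev.app hbx.symm hb.take)
  set L := Q ++ M ++ (P.reverse ++ ((x :: Y).reverse ++ (R₁ ++ [z]))) with hLdef
  have hp : (L ++ [zp, w]).Perm (Q ++ M ++ (R₁ ++ z :: zp :: w :: x :: Y) ++ P) := by
    refine List.perm_iff_count.2 fun y => ?_
    simp only [hLdef, List.count_append, List.count_cons, List.count_reverse, List.count_nil]
    omega
  refine ⟨?_, L, hL, ?_, ?_⟩
  · by_contra hlt
    exact S.no_longer (lost := [zp, w]) hL haz.symm hp hperm hP.2.1 (S.notMem hP)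
      (by simp; omega)
  · have h1 := hp.length_eq
    have h2 := hperm.length_eq
    simp only [List.length_append, List.length_cons, List.length_nil] at h1 h2
    omega
  · have : (Q ++ M ++ (R₁ ++ z :: zp :: w :: x :: Y) ++ P).Nodup := by
      rw [List.nodup_append]
      refine ⟨hperm.nodup_iff.2 S.nodup, hP.2.1, ?_⟩
      rintro y hy _ hy' rfl
      exact S.notMem hP y hy' (hperm.mem_iff.1 hy)
    have := List.nodup_append.1 (hp.nodup_iff.2 this)
    exact ⟨this.1, fun h => this.2.2 zp h zp (by simp) rfl,
      fun h => this.2.2 w h w (by simp) rfl⟩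

theorem not_cross_inner (S : Sit2 G C H A h₀)
    (c : Cfg G C A Q M (R₁ ++ z :: zp :: R₃) N a b u v) : ¬ Cross G C H a z := by
  intro hz
  obtain ⟨haz, Q₁, Q₂, s, x, T, rfl, hX, hlen, hx, hbx, hax, hsz, hszp⟩ :=
    c.of_cross S (zp := zp) (Y := R₃ ++ N) (by simp) hz
  have hazp := c.not_adj_of_cross S (zp := zp) (Y := R₃ ++ N) (by simp) hz
  have hbw := (c.not_adj_next S (zp := zp) (Y := R₃ ++ N) (by simp) hz).2
  have hE := c.extra_next S (zp := zp) (Y := R₃ ++ N) (by simp) hz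
  have hs := c.pth_start hX hx hax
  have hQ := (List.reverse_perm Q₁).append_right Q₂
  have hnd := c.symm.nodup_left S.toSit
  have hav := c.avR
  have hEs : Extra G A s b (Q₁.reverse ++ Q₂ ++ M) (R₁ ++ z :: zp :: R₃ ++ N) zp :=
    Or.inr ⟨R₁ ++ [z], R₃ ++ N, by simp, hszp, hbw, fun y hy => hav y (by simp at hy ⊢; tauto)⟩
  obtain ⟨w, Y, hw⟩ : ∃ w Y, R₃ ++ N = w :: Y := by
    obtain ⟨n, N', rfl, _⟩ := c.exists_N
    exact List.exists_cons_of_ne_nil (by simp)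
  obtain ⟨hsw, haw⟩ := c.not_adj_skip S hw haz hX hx hbx hsz
  obtain ⟨y, Y', rfl, hby⟩ : ∃ y Y', Y = y :: Y' ∧ G.Adj b y := by
    by_contra hcon
    have : Extra G A s b (Q₁.reverse ++ Q₂ ++ M) (R₁ ++ z :: zp :: R₃ ++ N) w := by
      refine Or.inr ⟨R₁ ++ [z, zp], Y, by simp [hw], hsw, ?_,
        fun y hy => hav y (by simp at hy ⊢; tauto)⟩
      intro e' he' hbe
      cases Y with
      | nil => simp at he'
      | cons y Y' =>
        simp at he'
        exact hcon ⟨y, Y', rfl, he' ▸ hbe⟩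
    have := c.extra_unique S hQ hs hEs this
    have e1 : R₁ ++ z :: zp :: R₃ ++ N = R₁ ++ z :: zp :: w :: Y := by simp [hw]
    rw [e1, this] at hnd
    simp [List.nodup_append] at hnd
  have hwA : w ∉ A := by
    cases R₃ with
    | nil =>
      intro hwA
      exact c.symm.not_adj_succ S.toSit (X := R₁ ++ [z, zp]) (m := w) (e := y) (Y := Y') hwA
        (by simp [← hw]) hby
    | cons w' R₃ =>
      simp at hw
      exact hav w (by simp [hw.1])
  have e1 : R₁ ++ z :: zp :: R₃ ++ N = R₁ ++ z :: zp :: w :: y :: Y' := by simp [hw]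
  have hdeg : ∀ h ∈ H, A.card + H.card ≤ deg G h + 1 := by
    intro h hh
    have := c.forced_all S (List.Perm.refl _) c.pa (E := {zp}) (by simpa using hE) hh
    simp at this
    omega
  obtain ⟨P, hP⟩ := S.lk2 u c.uA v c.vA (c.ne S.toSit)
  have hbyp : ∀ P, HLink G H 0 u P v → _ := fun P hP => c.bypass S.toSit e1 haz hby hP
  obtain ⟨hP2, L, hL, hLlen, hLnd, hzpL, hwL⟩ := hbyp P ⟨hP.1, hP.2.1, hP.2.2.1, by simp⟩
  have hPl := hP.2.2.2
  have hpath : G.Adj w zp := by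
    have := c.pb
    rw [e1] at this
    have : Pth G b ((R₁ ++ [z]) ++ zp :: w :: (y :: Y')) u := by simpa using this
    exact this.adj.symm
  have hdw := S.best a z L w zp hL haz.symm hLnd (by omega) hwL hzpL hpath
  have hHc : H.card ≤ 2 := by
    by_contra hcon
    obtain ⟨h₁, m₁, h₂, m₂, h₃, m₃, n₁₂, n₁₃, n₂₃⟩ := Finset.two_lt_card.1 (by omega : 2 < H.card)
    have f₁ := S.adj_of_card_le m₁ (hdeg _ m₁)
    have f₂ := S.adj_of_card_le m₂ (hdeg _ m₂)
    have f₃ := S.adj_of_card_le m₃ (hdeg _ m₃)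
    have := (hbyp [h₁, h₂, h₃] ⟨by
      simp [Link, (f₁.2 u c.uA).symm, f₃.2 v c.vA, f₁.1 h₂ m₂ n₁₂.symm, f₂.1 h₃ m₃ n₂₃.symm],
      by simp [n₁₂, n₁₃, n₂₃], by simp [m₁, m₂, m₃], by simp⟩).1
    simp at this
  have hdh := S.deg_add_one_le S.h₀_mem
  have hfl := Finset.card_filter_le A (fun x => G.Adj h₀ x)
  have haA := c.avQ a c.a_mem
  have hzA : z ∉ A := hav z (by simp)
  have hzpA : zp ∉ A := hav zp (by simp)
  have hda := S.deg_bound (L := Q₁ ++ Q₂ ++ M ++ (R₁ ++ z :: zp :: R₃ ++ N))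
    (X := Q₁ ++ Q₂ ++ M ++ R₁) (Y := y :: Y') c.symm.pb_long c.ua c.perm c.uA haA
    (fun x hx hne => S.lk2 x hx u c.uA hne) (by simp [hw]) hzA hzpA haz hazp haw
  have haC : a ∈ C := c.perm.mem_iff.1 (List.mem_append_left _ c.pa.head_mem)
  have hwC : w ∈ C := c.perm.mem_iff.1 (by rw [e1]; simp)
  have hne : a ≠ w := (List.nodup_append.1 (c.perm.nodup_iff.2 S.nodup)).2.2 a c.pa.head_mem w
    (by rw [e1]; simp)
  have hsig := S.sig a w h₀ hne (fun e => S.disj h₀ S.h₀_mem (e ▸ hwC))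
    (fun e => S.disj h₀ S.h₀_mem (e ▸ haC)) haw (S.not_adj hwC hwA S.h₀_mem)
    (S.not_adj haC haA S.h₀_mem)
  have hH2 : 2 ≤ H.card := by
    have := List.toFinset_card_of_nodup hP.2.1
    have h2 : P.toFinset ⊆ H := fun x hx => hP.2.2.1 x (by simpa using hx)
    have := Finset.card_le_card h2
    omega
  omega

/-- No vertex of `R` is reached from `a` by a crossing. -/
theorem not_cross_start (S : Sit2 G C H A h₀) (c : Cfg G C A Q M R N a b u v) (hz : z ∈ R) :
    ¬ Cross G C H a z := by
  intro hc
  obtain ⟨R₁, R₂, rfl⟩ := List.append_of_mem hz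
  cases R₂ with
  | cons zp R₃ => exact c.not_cross_inner S hc
  | nil =>
    obtain ⟨n, N', rfl, _⟩ := c.exists_N
    obtain ⟨haz, Q₁, Q₂, s, x, T, rfl, hX, hlen, -, -, -, hsz, -⟩ :=
      c.of_cross S (zp := n) (Y := N') (by simp) hc
    obtain ⟨a', b', u', v', c', ⟨R', hR'⟩, -, -, -⟩ := c.mirror
    obtain rfl := (List.append_singleton_inj.1 hR').2
    obtain ⟨Q₀, rfl⟩ := hX.exists_snoc
    obtain ⟨Q', t, rfl⟩ := exists_snoc_of_ne_nil (l := Q₀) (by rintro rfl; simp at hlen)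
    have c'' : Cfg G C A (R₁ ++ [z]).reverse M.reverse (Q₂.reverse ++ s :: t :: Q'.reverse)
        (n :: N').reverse z b' u' v' := by
      simpa using c'
    exact c''.not_cross_inner S (cross_of_adj hsz.symm)

theorem not_cross_of_not_defX (S : Sit2 G C H A h₀) (c : Cfg G C A Q M R N a b u v)
    (hno : ∀ e, ¬ DefX A (G.Adj b) (G.Adj a) (R ++ N) e) (hy : y ∈ Q) (hz : z ∈ R) :
    ¬ Cross G C H y z := by
  intro hc
  have hbQ : ∀ x ∈ Q, ¬ G.Adj b x := fun x hx h => c.symm.not_cross_start S hx (cross_of_adj h)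
  have haz : ¬ G.Adj a z := fun h => c.not_cross_start S hz (cross_of_adj h)
  obtain ⟨a', b', u', v', c', -, ⟨Q', hQ'⟩, -, -⟩ := c.mirror
  obtain ⟨X, Q₂, rfl⟩ := List.append_of_mem hy
  obtain ⟨R₁, R₂, rfl⟩ := List.append_of_mem hz
  obtain ⟨zp, Y, hzp⟩ : ∃ zp Y, R₂ ++ N = zp :: Y := by
    obtain ⟨n, N', rfl, _⟩ := c.exists_N
    exact List.exists_cons_of_ne_nil (by simp)
  have e1 : R₁ ++ z :: R₂ ++ N = R₁ ++ z :: zp :: Y := by simp [hzp]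
  have hbzp : G.Adj b zp := by
    by_contra h
    exact hno z ⟨R₁, zp :: Y, e1, haz, by simpa using h, fun x hx => c.avR x (by simp [hx])⟩
  have hpb := c.pb
  rw [e1] at hpb
  have c₁ : Cfg G C A (X ++ y :: Q₂) M ((R₁ ++ [z]) ++ R₂) N a b u v := by simpa using c
  have hz' := c₁.symm.pth_start hpb.take hzp hbzp
  have hperm := c₁.symm.perm_of ((List.reverse_perm (R₁ ++ [z])).append_right R₂)
  replace hperm := List.perm_append_comm.trans hperm
  obtain ⟨P, hP⟩ := S.lk2 u c.uA v c.vA (c.ne S.toSit)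
  have hPl := hP.2.2.2
  obtain ⟨W, hW, hW'⟩ := hc.symm
  cases Q₂ with
  | nil =>
    obtain rfl := (List.append_singleton_inj.1 hQ').2
    exact c'.symm.not_cross_start S (z := z) (by simp) ⟨W.reverse, hW.rev, hW'.rev⟩
  | cons y' Q₂ =>
    obtain ⟨w, T, hw⟩ : ∃ w T, Q₂ ++ M = w :: T := by
      obtain ⟨n, M', rfl, _⟩ := c.exists_M
      exact List.exists_cons_of_ne_nil (by simp)
    have e2 : X ++ y :: y' :: Q₂ ++ M = X ++ y :: y' :: w :: T := by simp [hw]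
    have hpa := c.pa
    have hnd := c.nodup_left S.toSit
    rw [e2] at hpa hperm hnd
    have h1 : ¬ G.Adj a y' :=
      S.pair_cross (F := []) hpa hz' hperm hP hW hW' (by simp; omega)
    have h2 : ¬ G.Adj a w :=
      S.pair_cross (F := [y']) hpa hz' hperm hP hW hW' (by simp; omega)
    have := c.extra_unique' S (e₁ := y) (e₂ := y')
      (Or.inl ⟨X, y' :: w :: T, e2, hbQ y (by simp), by simpa using h1,
        fun x hx => c.avQ x (by simp [hx])⟩)
      (Or.inl ⟨X ++ [y], w :: T, by simp [hw], hbQ y' (by simp), by simpa using h2,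
        fun x hx => c.avQ x (by simp at hx ⊢; tauto)⟩)
    rw [this] at hnd
    simp [List.nodup_append] at hnd

/-- There are no crossings between `Q` and `R`. -/
theorem not_cross (S : Sit2 G C H A h₀) (c : Cfg G C A Q M R N a b u v) (hy : y ∈ Q)
    (hz : z ∈ R) : ¬ Cross G C H y z := by
  by_cases h₁ : ∃ e, DefX A (G.Adj b) (G.Adj a) (R ++ N) e
  · by_cases h₂ : ∃ e, DefX A (G.Adj a) (G.Adj b) (Q ++ M) e
    · obtain ⟨e₁, h₁⟩ := h₁
      obtain ⟨e₂, h₂⟩ := h₂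
      have := c.extra_unique' S (Or.inr h₁) (Or.inl h₂)
      obtain ⟨X, Y, h₁, _⟩ := h₁
      obtain ⟨X', Y', h₂, _⟩ := h₂
      exact absurd this.symm ((List.nodup_append.1 (c.perm.nodup_iff.2 S.nodup)).2.2 e₂
        (by rw [h₂]; simp) e₁ (by rw [h₁]; simp))
    · push Not at h₂
      exact fun h => c.symm.not_cross_of_not_defX S h₂ hz hy h.symm
  · push Not at h₁
    exact c.not_cross_of_not_defX S h₁ hy hz

end Cfg

end NoCrossing

section Arrangement

variable {G : SimpleGraph V} {C : List V} {H A : Finset V}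
  {L P X Y Z L₁ L₂ : List V} {a b u v h₀ y z : V}

/-- `L` lists the vertices of a cycle in cyclic order. -/
def ClosedList (G : SimpleGraph V) (L : List V) : Prop := ∃ a b, Pth G a L b ∧ G.Adj b a

theorem ClosedList.rotate (h : ClosedList G (X ++ u :: Y)) :
    ∃ a, Pth G a (Y ++ (X ++ [u])) u ∧ G.Adj u a := by
  obtain ⟨a, b, h1, h2⟩ := h
  cases Y with
  | nil =>
    obtain rfl : u = b := by simpa using h1.2.2
    exact ⟨a, by simpa using h1, h2⟩
  | cons y Y =>
    have h3 : Pth G a ((X ++ [u]) ++ y :: Y) b := by simpa using h1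
    exact ⟨y, h3.drop.app h2 h1.take, h1.adj⟩

theorem mem_left_of_append {Q M : List V} (h : Q ++ M = X ++ y :: Y) (hX : ∀ x ∈ X, x ∉ A)
    (hy : y ∉ A) (hM : ∀ x ∈ M.head?, x ∈ A) : y ∈ Q := by
  induction Q generalizing X with
  | nil =>
    subst h
    cases X with
    | nil => exact absurd (hM y (by simp)) hy
    | cons x X => exact absurd (hM x (by simp)) (hX x (by simp))
  | cons q Q ih =>
    cases X with
    | nil => simp at h; simp [h.1]
    | cons x X =>
      simp at h
      exact List.mem_cons_of_mem _ (ih h.2 (fun x hx => hX x (by simp [hx])))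

theorem hLink_of_pth {h h' : V} (hu : G.Adj u h) (hv : G.Adj h' v) (hP : Pth G h P h')
    (hnd : P.Nodup) (hH : ∀ x ∈ P, x ∈ H) : HLink G H 1 u P v := by
  refine ⟨?_, hnd, hH, ?_⟩
  · have := (pth_singleton (G := G) (a := u)).app hu (hP.app hv pth_singleton)
    exact this.1
  · have := hP.ne_nil
    cases P <;> simp_all

theorem hLink_of_pth_of_ne {h h' : V} (hu : G.Adj u h) (hv : G.Adj h' v) (hP : Pth G h P h')
    (hnd : P.Nodup) (hH : ∀ x ∈ P, x ∈ H) (hne : h ≠ h') : HLink G H 2 u P v := by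
  have h1 := hLink_of_pth hu hv hP hnd hH
  refine ⟨h1.1, h1.2.1, h1.2.2.1, ?_⟩
  obtain ⟨T, rfl⟩ := hP.exists_cons
  cases T with
  | nil =>
    have := hP.2.2
    simp at this
    exact absurd this hne
  | cons => simp

variable [Fintype V]

theorem Sit.exists_cfg (S : Sit G C H A) (h₁ : Pth G a L₁ v) (h₂ : Pth G b L₂ u)
    (hua : G.Adj u a) (hvb : G.Adj v b) (hp : (L₁ ++ L₂).Perm C) (hu : u ∈ A) (hv : v ∈ A) :
    ∃ Q M R N, Cfg G C A Q M R N a b u v ∧ L₁ = Q ++ M ∧ L₂ = R ++ N := by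
  have start : ∀ {a v b u : V} {L₁ L₂ : List V}, Pth G a L₁ v → Pth G b L₂ u → G.Adj u a →
      G.Adj v b → (L₁ ++ L₂).Perm C → u ∈ A → v ∈ A → ∃ Q M, L₁ = Q ++ M ∧ Q ≠ [] ∧
        (∀ x ∈ Q, x ∉ A) ∧ ∀ x ∈ M.head?, x ∈ A := by
    intro a v b u L₁ L₂ h₁ h₂ hua hvb hp hu hv
    have ha : a ∉ A := by
      intro ha
      obtain ⟨T, rfl⟩ := h₁.exists_cons
      obtain ⟨N, rfl⟩ := h₂.exists_snoc
      refine S.succ_notMem (X := N) (c := u) (e := a) (Y := T) (a := b) (u := v) ?_ hvb ?_ hu ha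
      · simpa using h₂.app hua h₁
      · refine List.Perm.trans ?_ hp
        simpa using List.perm_append_comm (l₁ := N ++ [u]) (l₂ := a :: T)
    rcases exists_first (· ∈ A) L₁ with h | ⟨Q, m, M, rfl, hm, hQ⟩
    · exact absurd hv (h v h₁.last_mem)
    · refine ⟨Q, m :: M, rfl, ?_, hQ, by simpa using hm⟩
      rintro rfl
      obtain ⟨T, hT⟩ := h₁.exists_cons
      simp at hT
      exact ha (hT.1 ▸ hm)
  obtain ⟨Q, M, rfl, q1, q2, q3⟩ := start h₁ h₂ hua hvb hp hu hv
  obtain ⟨R, N, rfl, r1, r2, r3⟩ := start h₂ h₁ hvb hua (List.perm_append_comm.trans hp) hv hu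
  exact ⟨Q, M, R, N, ⟨hp, h₁, h₂, hua, hvb, q1, r1, q2, r2, q3, r3, hu, hv⟩, rfl, rfl⟩

/-- Crossing vertices of a longest cycle are not separated by attachments. -/
theorem Sit2.not_cross (S : Sit2 G C H A h₀) (hL : Pth G a (X ++ y :: (Y ++ z :: Z)) u)
    (hu : G.Adj u a) (hp : (X ++ y :: (Y ++ z :: Z)).Perm C) (huA : u ∈ A)
    (hX : ∀ x ∈ X, x ∉ A) (hy : y ∉ A) (hz : z ∉ A) (hY : ∃ c ∈ Y, c ∈ A) :
    ¬ Cross G C H y z := by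
  obtain ⟨c, hc, hcA⟩ := hY
  rcases exists_last (· ∈ A) Y with h | ⟨Y₁, v, Y₂, rfl, hv, hY₂⟩
  · exact absurd hcA (h c hc)
  obtain ⟨b, T, hb⟩ : ∃ b T, Y₂ ++ z :: Z = b :: T := List.exists_cons_of_ne_nil (by simp)
  have hL' : Pth G a ((X ++ y :: Y₁) ++ v :: b :: T) u := by rw [← hb]; simpa using hL
  have hL'' : Pth G a ((X ++ y :: Y₁ ++ [v]) ++ b :: T) u := by simpa using hL'
  have hp' : ((X ++ y :: Y₁ ++ [v]) ++ b :: T).Perm C := by rw [← hb]; simpa using hp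
  obtain ⟨Q, M, R, N, c, h1, h2⟩ := S.exists_cfg (by simpa using hL'.take) hL''.drop hu
    hL'.adj hp' huA hv
  refine c.not_cross S (mem_left_of_append (X := X) (Y := Y₁ ++ [v]) ?_ hX hy c.hM)
    (mem_left_of_append (X := Y₂) (Y := Z) ?_ hY₂ hz c.hN)
  · rw [← h1]; simp
  · rw [← h2, hb]

/-- If `H` is connected with at least two vertices, any two attachments have a long link. -/
theorem Sit.exists_long_link (S : Sit G C H A) (hC : ClosedList G C)
    (hconn : ∀ h ∈ H, ∀ h' ∈ H, ∃ P, Pth G h P h' ∧ P.Nodup ∧ ∀ x ∈ P, x ∈ H)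
    (hA : ∀ c ∈ A, ∃ h ∈ H, G.Adj h c) (hH : 2 ≤ H.card) (hu : u ∈ A) (hv : v ∈ A)
    (huv : u ≠ v) : ∃ P, HLink G H 2 u P v := by
  by_contra hno
  have link : ∀ c d h h' : V, h ∈ H → h' ∈ H → h ≠ h' → G.Adj h c → G.Adj h' d →
      ∃ P, HLink G H 2 c P d := by
    intro c d h h' hh hh' hne hc hd
    obtain ⟨P, h1, h2, h3⟩ := hconn h hh h' hh'
    exact ⟨P, hLink_of_pth_of_ne hc.symm hd h1 h2 h3 hne⟩
  have hsame : ∀ h ∈ H, ∀ h' ∈ H, G.Adj h u → G.Adj h' v → h = h' := by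
    intro h hh h' hh' h1 h2
    by_contra hne
    exact hno (link u v h h' hh hh' hne h1 h2)
  obtain ⟨k, hk, hku⟩ := hA u hu
  obtain ⟨k', hk', hkv⟩ := hA v hv
  obtain rfl := hsame k hk k' hk' hku hkv
  obtain ⟨h, hh, hne⟩ := Finset.exists_mem_ne (by omega : 1 < H.card) k
  obtain ⟨X, Y, rfl⟩ := List.append_of_mem (S.sub u hu)
  obtain ⟨a, hL, hua⟩ := hC.rotate
  have hp : (Y ++ (X ++ [u])).Perm (X ++ u :: Y) := by
    simpa using List.perm_append_comm (l₁ := Y) (l₂ := X ++ [u])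
  obtain ⟨Z, e, W, hZ⟩ := Pth.exists_succ (L := []) hL (hp.mem_iff.2 (S.sub v hv)) huv.symm
  replace hZ : Y ++ (X ++ [u]) = Z ++ v :: e :: W := hZ
  rw [hZ] at hL hp
  have hL' : Pth G a ((Z ++ [v]) ++ e :: W) u := by simpa using hL
  obtain ⟨Q, M, R, N, c, -, -⟩ := S.exists_cfg hL.take hL'.drop hua hL.adj (by simpa using hp)
    hu hv
  have hB := c.forced S (List.Perm.refl _) c.pa (B := A.filter fun x => G.Adj h x) (E := ∅) (by
    intro x hx
    obtain ⟨hxA, hhx⟩ := Finset.mem_filter.1 hx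
    refine ⟨hxA, ?_, ?_, link x u h k hh hk hne hhx hku, link x v h k hh hk hne hhx hkv⟩
    · rintro rfl
      exact hne (hsame h hh k hk hhx hkv)
    · rintro rfl
      exact hne (hsame k hk h hh hku hhx).symm) (by simp) hh
  have := S.deg_add_one_le hh
  simp at hB
  omega

end Arrangement

section Toughness

variable {G : SimpleGraph V} {C : List V} {H A : Finset V} {L X Y : List V}
  {a b c c' e e' h₀ x y : V}

/-- Every set closed under adjacency outside `T` that contains `x` contains `y`. -/
def ReachOff (G : SimpleGraph V) (T : Set V) (x y : V) : Prop :=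
  ∀ K : Set V, (∀ x ∈ K, ∀ y, y ∉ T → G.Adj x y → y ∈ K) → x ∈ K → y ∈ K

theorem reachOff_of_reachable {T : Set V} {x y : (Tᶜ : Set V)}
    (h : (G.induce Tᶜ).Reachable x y) : ReachOff G T x y := by
  intro K hK hx
  obtain ⟨p⟩ := h
  induction p with
  | nil => exact hx
  | @cons u v w huv _ ih => exact ih (hK _ hx _ v.2 huv)

theorem OneTough.exists_reachOff [Fintype V] (hG : OneTough G) {T : Set V} (hT : T.Nonempty)
    {h : V} (hh : h ∉ T) {f : V → V} (hf : ∀ c ∈ T, f c ∉ T) :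
    (∃ c ∈ T, ReachOff G T h (f c)) ∨
      ∃ c ∈ T, ∃ c' ∈ T, c ≠ c' ∧ ReachOff G T (f c) (f c') := by
  let g : Option T → (G.induce Tᶜ).ConnectedComponent := fun o =>
    (G.induce Tᶜ).connectedComponentMk
      (o.elim ⟨h, hh⟩ fun c => ⟨f c, hf c c.2⟩)
  have hg : ¬ Function.Injective g := by
    intro hinj
    have h1 := Nat.card_le_card_of_injective g hinj
    have h2 := hG T hT
    rw [Finite.card_option, Nat.card_coe_set_eq] at h1
    omega
  simp only [Function.Injective, not_forall] at hg
  obtain ⟨o, o', h1, h2⟩ := hg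
  have h3 := reachOff_of_reachable (SimpleGraph.ConnectedComponent.exact h1)
  have h4 := reachOff_of_reachable (SimpleGraph.ConnectedComponent.exact h1.symm)
  match o, o', h2, h3, h4 with
  | none, none, h2, _, _ => exact absurd rfl h2
  | none, some c, _, h3, _ => exact Or.inl ⟨c, c.2, h3⟩
  | some c, none, _, _, h4 => exact Or.inl ⟨c, c.2, h4⟩
  | some c, some c', h2, h3, _ =>
    exact Or.inr ⟨c, c.2, c', c'.2, fun h => h2 (by rw [Subtype.ext h]), h3⟩

/-- `e` follows `c` on the cyclic list `C`. -/
def CSucc (C : List V) (c e : V) : Prop :=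
  ∃ X Y T, C = X ++ c :: Y ∧ Y ++ (X ++ [c]) = e :: T

theorem exists_cSucc (hc : c ∈ C) : ∃ e, CSucc C c e := by
  obtain ⟨X, Y, rfl⟩ := List.append_of_mem hc
  obtain ⟨e, T, h⟩ := List.exists_cons_of_ne_nil (l := Y ++ (X ++ [c])) (by simp)
  exact ⟨e, X, Y, T, rfl, h⟩

theorem CSucc.mem (h : CSucc C c e) : e ∈ C := by
  obtain ⟨X, Y, T, rfl, h⟩ := h
  have : e ∈ Y ++ (X ++ [c]) := by simp [h]
  simp at this ⊢
  tauto

theorem CSucc.rotate (hC : C.Nodup) (hs : CSucc C c' e') (hne : c' ≠ c)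
    (h : C = X ++ c :: Y) : ∃ Z W, Y ++ (X ++ [c]) = Z ++ c' :: e' :: W := by
  obtain ⟨X', Y', T, h1, h2⟩ := hs
  have hmem : c' ∈ X ++ c :: Y := by rw [← h, h1]; simp
  rcases List.mem_append.1 hmem with hX | hY
  · obtain ⟨X₁, X₂, rfl⟩ := List.append_of_mem hX
    obtain ⟨rfl, rfl⟩ := split_unique hC h1 (X' := X₁) (Y' := X₂ ++ c :: Y) (by simp [h])
    cases X₂ with
    | nil =>
      simp at h2
      exact ⟨Y ++ X', [], by simp [h2.1]⟩
    | cons x X₂ =>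
      simp at h2
      exact ⟨Y ++ X', X₂ ++ [c], by simp [h2.1]⟩
  · have hY := (List.mem_cons.1 hY).resolve_left hne
    obtain ⟨Y₁, Y₂, rfl⟩ := List.append_of_mem hY
    obtain ⟨rfl, rfl⟩ := split_unique hC h1 (X' := X ++ c :: Y₁) (Y' := Y₂) (by simp [h])
    cases Y' with
    | nil =>
      cases X with
      | nil =>
        simp at h2
        exact ⟨Y₁, [], by simp [h2.1]⟩
      | cons x X =>
        simp at h2
        exact ⟨Y₁, X ++ [c], by simp [h2.1]⟩
    | cons y Y' =>
      simp at h2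
      exact ⟨Y₁, Y' ++ (X ++ [c]), by simp [h2.1]⟩

variable [Fintype V]

theorem Sit.cSucc_notMem (S : Sit G C H A) (hC : ClosedList G C) (hs : CSucc C c e)
    (hc : c ∈ A) : e ∉ A := by
  intro he
  obtain ⟨X, Y, T, rfl, h⟩ := hs
  obtain ⟨a, hL, hca⟩ := hC.rotate
  rw [h] at hL
  obtain rfl : e = a := by simpa using hL.2.1
  obtain ⟨P, hP⟩ := S.lk c hc e he hca.ne
  obtain ⟨b', h1, h2⟩ := hL.close hP.1
  refine S.no_longer (E := P) (lost := []) h1 h2 (K := e :: T) (by simp) ?_ hP.2.1 (S.notMem hP)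
    (by have := hP.2.2.2; simp; omega)
  rw [← h]
  simpa using List.perm_append_comm (l₁ := Y) (l₂ := X ++ [c])

theorem Sit2.not_reachOff (S : Sit2 G C H A h₀) (hC : ClosedList G C) (hc : c ∈ A)
    (hc' : c' ∈ A) (hne : c ≠ c') (hs : CSucc C c e) (hs' : CSucc C c' e') :
    ¬ ReachOff G A e e' := by
  intro hr
  have heA := S.cSucc_notMem hC hs hc
  have heA' := S.cSucc_notMem hC hs' hc'
  obtain ⟨X, Y, T, hX, hT⟩ := hs
  obtain ⟨Z, W, hZ⟩ := hs'.rotate S.nodup hne.symm hX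
  obtain ⟨a, hL, hca⟩ : ∃ a, Pth G a (Y ++ (X ++ [c])) c ∧ G.Adj c a := by
    rw [hX] at hC; exact hC.rotate
  have hp : (Y ++ (X ++ [c])).Perm C := by
    rw [hX]
    simpa using List.perm_append_comm (l₁ := Y) (l₂ := X ++ [c])
  set L := Y ++ (X ++ [c])
  have hnd := hp.nodup_iff.2 S.nodup
  rcases exists_first (· ∈ A) L with h | ⟨Q, m, M, hQ, hm, hQA⟩
  · exact h c hL.last_mem hc
  have heQ : e ∈ Q := by
    rw [hT] at hQ
    cases Q with
    | nil => simp at hQ; exact absurd (hQ.1 ▸ hm) heA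
    | cons q Q => simp at hQ; simp [hQ.1]
  have hcross : ∀ y ∈ Q, ∀ w ∈ C, w ∉ A → Cross G C H y w → w ∈ Q := by
    intro y hy w hw hwA hyw
    have hwL := hp.mem_iff.2 hw
    rw [hQ] at hwL
    rcases List.mem_append.1 hwL with h | h
    · exact h
    have hwM := (List.mem_cons.1 h).resolve_left (fun h => hwA (h ▸ hm))
    obtain ⟨M₁, M₂, rfl⟩ := List.append_of_mem hwM
    obtain ⟨Q₁, Q₂, rfl⟩ := List.append_of_mem hy
    have e1 : L = Q₁ ++ y :: ((Q₂ ++ m :: M₁) ++ w :: M₂) := by simp [hQ]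
    rw [e1] at hL hp
    exact absurd hyw (S.not_cross hL hca hp hc (fun x hx => hQA x (by simp [hx]))
      (hQA y (by simp)) hwA ⟨m, by simp, hm⟩)
  have hQC : ∀ y ∈ Q, y ∈ C := fun y hy => hp.mem_iff.1 (by rw [hQ]; simp [hy])
  have hK := hr {x | x ∈ Q ∨ x ∉ C ∧ x ∉ H ∧ ∃ y ∈ Q, ∃ W, OutList C H (W ++ [x]) ∧
    Link G y W x} (by
    rintro x hx w hwA hxw
    by_cases hwC : w ∈ C
    · left
      rcases hx with hx | ⟨hxC, hxH, y, hy, W, hW, hW'⟩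
      · exact hcross x hx w hwC hwA (cross_of_adj hxw)
      · refine hcross y hy w hwC hwA ⟨W ++ [x], hW, ?_⟩
        have : Pth G y [y] y := pth_singleton
        have := (this.link hW' ((pth_singleton (a := x)).app hxw pth_singleton)).1
        simpa [Link] using this
    · right
      have hwH : w ∉ H := by
        intro hwH
        rcases S.closed w hwH x hxw.symm with h | h
        · rcases hx with hx | hx
          · exact S.disj x h (hQC x hx)
          · exact hx.2.1 h
        · rcases hx with hx | hx
          · exact hQA x hx h
          · exact hx.1 (S.sub x h)
      refine ⟨hwC, hwH, ?_⟩
      rcases hx with hx | ⟨hxC, hxH, y, hy, W, hW, hW'⟩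
      · exact ⟨x, hx, [], by simpa using outList_singleton hwC hwH, link_nil.2 hxw⟩
      · refine ⟨y, hy, ?_⟩
        by_cases hwW : w ∈ W
        · obtain ⟨W₁, W₂, rfl⟩ := List.append_of_mem hwW
          refine ⟨W₁, ⟨?_, fun v hv => hW.2 v (by simp at hv ⊢; tauto)⟩, ?_⟩
          · have := hW.1
            rw [show W₁ ++ w :: W₂ ++ [x] = (W₁ ++ [w]) ++ (W₂ ++ [x]) by simp] at this
            exact (List.nodup_append.1 this).1
          · unfold Link at hW'
            have : ((y :: W₁) ++ w :: (W₂ ++ [x])).IsChain G.Adj := by simpa using hW'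
            have := (List.isChain_split.1 this).1
            simpa [Link] using this
        · refine ⟨W ++ [x], ⟨?_, ?_⟩, ?_⟩
          · rw [List.nodup_append]
            refine ⟨hW.1, by simp, ?_⟩
            rintro v hv _ hw rfl
            obtain rfl := List.mem_singleton.1 hw
            rcases List.mem_append.1 hv with hv | hv
            · exact hwW hv
            · exact hxw.ne (List.mem_singleton.1 hv).symm
          · intro v hv
            rcases List.mem_append.1 hv with hv | hv
            · exact hW.2 v hv
            · obtain rfl := List.mem_singleton.1 hv
              exact ⟨hwC, hwH⟩
          · have : Pth G y [y] y := pth_singleton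
            have := (this.link hW' ((pth_singleton (a := x)).app hxw pth_singleton)).1
            simpa [Link] using this) (Or.inl heQ)
  rcases hK with h | h
  · obtain ⟨Q₁, Q₂, rfl⟩ := List.append_of_mem h
    have h1 : L = (Z ++ [c']) ++ e' :: W := by simp [hZ]
    obtain ⟨h2, -⟩ := split_unique hnd h1 (X' := Q₁) (Y' := Q₂ ++ m :: M) (by simp [hQ])
    exact hQA c' (by simp [← h2]) hc'
  · exact h.1 hs'.mem

theorem Sit2.not_oneTough (S : Sit2 G C H A h₀) (hC : ClosedList G C) : ¬ OneTough G := by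
  intro hG
  have hHcl : ∀ T : Set V, ↑A ⊆ T → ∀ x ∈ (H : Set V), ∀ y, y ∉ T → G.Adj x y → y ∈ (H : Set V) :=
    fun T hT x hx y hy hxy => (S.closed x hx y hxy).resolve_right (fun h => hy (hT h))
  have hsucc : ∀ c, ∃ e, c ∈ C → CSucc C c e := fun c => by
    by_cases hc : c ∈ C
    · obtain ⟨e, he⟩ := exists_cSucc hc
      exact ⟨e, fun _ => he⟩
    · exact ⟨c, fun h => absurd h hc⟩
  choose f hf using hsucc
  rcases A.eq_empty_or_nonempty with rfl | hA
  · obtain ⟨c, hc⟩ := List.exists_mem_of_length_pos (l := C) (by have := S.len; omega)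
    have hcf : f c ≠ c := by
      obtain ⟨X, Y, T, hX, h⟩ := hf c hc
      have hCC := hC
      rw [hX] at hCC
      obtain ⟨a, hL, hca⟩ := hCC.rotate
      rw [h] at hL
      have : f c = a := by simpa using hL.2.1
      exact this ▸ hca.ne'
    have hcH : h₀ ∉ ({c} : Set V) := by
      rintro rfl
      exact S.disj _ S.h₀_mem hc
    rcases hG.exists_reachOff (T := {c}) (by simp) hcH (f := f) (by simpa using hcf) with
      ⟨c₁, rfl, h⟩ | ⟨c₁, rfl, c₂, rfl, hne, -⟩
    · exact S.disj _ (h H (hHcl _ (by simp)) S.h₀_mem) (hf _ hc).mem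
    · exact hne rfl
  · have hcH : h₀ ∉ (A : Set V) := fun h => S.disj _ S.h₀_mem (S.sub _ h)
    rcases hG.exists_reachOff (T := A) hA hcH (f := f)
      (fun c hc => S.cSucc_notMem hC (hf c (S.sub c hc)) hc) with
      ⟨c, hc, h⟩ | ⟨c, hc, c', hc', hne, h⟩
    · exact S.disj _ (h H (hHcl _ subset_rfl) S.h₀_mem) (hf _ (S.sub c hc)).mem
    · exact S.not_reachOff hC hc hc' hne (hf c (S.sub c hc)) (hf c' (S.sub c' hc')) h

end Toughness

section Walks

variable {G : SimpleGraph V} {C L : List V} {a b s t : V}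

theorem pth_support (p : G.Walk a b) : Pth G a p.support b := by
  refine ⟨p.isChain_adj_support, ?_, ?_⟩
  · cases p <;> simp
  · rw [List.getLast?_eq_some_getLast p.support_ne_nil, p.getLast_support]

theorem Pth.exists_walk (h : Pth G a L b) : ∃ p : G.Walk a b, p.support = L := by
  obtain ⟨h1, h2, h3⟩ := h
  have hL : L ≠ [] := by rintro rfl; simp at h2
  have ha : L.head hL = a := by simpa [List.head?_eq_some_head hL] using h2
  have hb : L.getLast hL = b := by simpa [List.getLast?_eq_some_getLast hL] using h3
  subst ha hb
  exact ⟨.ofSupport L hL h1, SimpleGraph.Walk.support_ofSupport hL h1⟩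

theorem exists_closedList_of_isCycle {c : G.Walk a a} (hc : c.IsCycle) :
    ∃ C, ClosedList G C ∧ C.Nodup ∧ C.length = c.length ∧ ∀ x, x ∈ C → x ∈ c.support := by
  cases c with
  | nil => simp at hc
  | cons h p =>
    rw [SimpleGraph.Walk.cons_isCycle_iff] at hc
    exact ⟨p.support, ⟨_, _, pth_support p, h⟩, hc.1.support_nodup, by simp,
      fun x hx => by simp [hx]⟩

theorem Pth.exists_isCycle (h : Pth G a L b) (hba : G.Adj b a) (hL : L.Nodup)
    (h3 : 3 ≤ L.length) : ∃ c : G.Walk b b, c.IsCycle ∧ c.length = L.length := by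
  obtain ⟨p, rfl⟩ := h.exists_walk
  refine ⟨.cons hba p, ?_, by simp⟩
  rw [SimpleGraph.Walk.isCycle_iff_isPath_tail_and_le_length]
  refine ⟨?_, by simpa using h3⟩
  rw [SimpleGraph.Walk.isPath_def]
  simpa using hL

/-- The graph `G` with all edges meeting `C` deleted. -/
def offGraph (G : SimpleGraph V) (C : List V) : SimpleGraph V where
  Adj x y := G.Adj x y ∧ x ∉ C ∧ y ∉ C
  symm := ⟨fun _ _ h => ⟨h.1.symm, h.2.2, h.2.1⟩⟩
  loopless := ⟨fun _ h => h.1.ne rfl⟩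

theorem notMem_of_reachable (hs : s ∉ C) (h : (offGraph G C).Reachable s t) : t ∉ C := by
  obtain ⟨p⟩ := h
  induction p with
  | nil => exact hs
  | cons h _ ih => exact ih h.2.2

theorem exists_pth_of_reachable (h : (offGraph G C).Reachable s t) :
    ∃ P, Pth G s P t ∧ P.Nodup ∧ ∀ x ∈ P, (offGraph G C).Reachable s x := by
  obtain ⟨p, hp⟩ := h.exists_isPath
  obtain ⟨h1, h2⟩ := pth_support p
  exact ⟨p.support, ⟨h1.imp fun _ _ h => h.1, h2⟩, hp.support_nodup,
    fun x hx => ⟨p.takeUntil x hx⟩⟩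

theorem card_le_deg_add [Fintype V] (hsig : Fintype.card V ≤ sigma3 G) {x y z : V} (hxy : x ≠ y)
    (hyz : y ≠ z) (hxz : x ≠ z) (axy : ¬ G.Adj x y) (ayz : ¬ G.Adj y z) (axz : ¬ G.Adj x z) :
    Fintype.card V ≤ deg G x + deg G y + deg G z := by
  have ht : IsIndepTriple G {x, y, z} := by
    refine ⟨Finset.card_eq_three.2 ⟨x, y, z, hxy, hxz, hyz, rfl⟩, ?_⟩
    simp [hxy, hyz, hxz, axy, ayz, axz]
    exact ⟨fun _ h => axy h.symm, fun _ h => axz h.symm, fun _ h => ayz h.symm⟩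
  refine hsig.trans ?_
  rw [sigma3, if_pos ⟨_, ht⟩]
  exact Nat.sInf_le ⟨_, ht, by
    rw [Finset.sum_insert (by simp [hxy, hxz]), Finset.sum_pair hyz]; ring⟩

theorem exists_sit2 [Fintype V] (hC : ClosedList G C) (hnd : C.Nodup) (hlen : 3 ≤ C.length)
    (hmx : ∀ a b L, Pth G a L b → G.Adj b a → L.Nodup → 3 ≤ L.length → L.length ≤ C.length)
    (hs : s ∉ C) (ht : t ∉ C) (hst : G.Adj s t)
    (hbest : ∀ a b L s' t', Pth G a L b → G.Adj b a → L.Nodup → L.length = C.length →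
      s' ∉ L → t' ∉ L → G.Adj s' t' → deg G s' ≤ deg G s)
    (hsig : Fintype.card V ≤ sigma3 G) : ∃ H A, Sit2 G C H A s := by
  let H : Finset V := Finset.univ.filter fun x => (offGraph G C).Reachable s x
  let A : Finset V := Finset.univ.filter fun c => c ∈ C ∧ ∃ h ∈ H, G.Adj h c
  have hH : ∀ x, x ∈ H ↔ (offGraph G C).Reachable s x := by simp [H]
  have hA : ∀ c, c ∈ A ↔ c ∈ C ∧ ∃ h ∈ H, G.Adj h c := by simp [A]
  have hconn : ∀ h ∈ H, ∀ h' ∈ H, ∃ P, Pth G h P h' ∧ P.Nodup ∧ ∀ x ∈ P, x ∈ H := by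
    intro h hh h' hh'
    rw [hH] at hh hh'
    obtain ⟨P, h1, h2, h3⟩ := exists_pth_of_reachable (hh.symm.trans hh')
    exact ⟨P, h1, h2, fun x hx => (hH x).2 (hh.trans (h3 x hx))⟩
  have hdisj : ∀ h ∈ H, h ∉ C := fun h hh => notMem_of_reachable hs ((hH h).1 hh)
  have S : Sit G C H A := {
    nodup := hnd
    len := hlen
    mx := hmx
    disj := hdisj
    sub := fun c hc => ((hA c).1 hc).1
    closed := by
      intro h hh v hv
      by_cases hvC : v ∈ C
      · exact Or.inr ((hA v).2 ⟨hvC, h, hh, hv⟩)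
      · have hadj : (offGraph G C).Adj h v := ⟨hv, hdisj h hh, hvC⟩
        exact Or.inl ((hH v).2 (((hH h).1 hh).trans hadj.reachable))
    lk := by
      intro u hu v hv _
      obtain ⟨-, h, hh, hu⟩ := (hA u).1 hu
      obtain ⟨-, h', hh', hv⟩ := (hA v).1 hv
      obtain ⟨P, h1, h2, h3⟩ := hconn h hh h' hh'
      exact ⟨P, hLink_of_pth hu.symm hv h1 h2 h3⟩
    sig := fun _ _ _ => card_le_deg_add hsig }
  have hsH : s ∈ H := (hH s).2 (SimpleGraph.Reachable.refl s)
  have htH : t ∈ H := (hH t).2 (SimpleGraph.Adj.reachable (G := offGraph G C) ⟨hst, hs, ht⟩)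
  have hcard : 2 ≤ H.card := Finset.one_lt_card.2 ⟨s, hsH, t, htH, hst.ne⟩
  exact ⟨H, A, S, fun u hu v hv huv =>
    S.exists_long_link hC hconn (fun c hc => ((hA c).1 hc).2) hcard hu hv huv, hsH, hbest⟩

end Walks

theorem stmt0 {V : Type*} [Fintype V] (G : SimpleGraph V)
    (hn : 3 ≤ Fintype.card V) (htough : OneTough G) (hsig : Fintype.card V ≤ sigma3 G)
    {a : V} (c : G.Walk a a) (hc : IsLongestCycle G c) :
    ∀ x y : V, x ∉ c.support → y ∉ c.support → ¬ G.Adj x y := by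
  intro x y hx hy hxy
  let p : V → Prop := fun s => ∃ L t, ClosedList G L ∧ L.Nodup ∧ L.length = c.length ∧
    s ∉ L ∧ t ∉ L ∧ G.Adj s t
  have hp : (Finset.univ.filter p).Nonempty := by
    obtain ⟨C, h1, h2, h3, h4⟩ := exists_closedList_of_isCycle hc.1
    exact ⟨x, by simpa using ⟨C, y, h1, h2, h3, fun h => hx (h4 x h), fun h => hy (h4 y h), hxy⟩⟩
  obtain ⟨s, hs, hmax⟩ := Finset.exists_max_image _ (deg G) hp
  obtain ⟨C, t, hC, hnd, hlen, hsC, htC, hst⟩ := (Finset.mem_filter.1 hs).2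
  have h3 := hc.1.three_le_length
  obtain ⟨H, A, S⟩ := exists_sit2 hC hnd (hlen ▸ h3) (fun a b L hL hba hLnd hL3 => by
      obtain ⟨w, h1, h2⟩ := hL.exists_isCycle hba hLnd hL3
      rw [hlen, ← h2]
      exact hc.2 b w h1) hsC htC hst
    (fun a b L s' t' hL hba hLnd hLlen hs' ht' hst' => hmax s' (by
      simpa using ⟨L, t', ⟨a, b, hL, hba⟩, hLnd, hLlen.trans hlen, hs', ht', hst'⟩)) hsig
  exact S.not_oneTough hC htough

end
end Paper
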